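/- arXiv:0906.3598 — 2 statements merged into one kernel-verified Lean document; each statement's English description precedes it below -/
import Mathlib

section
/- Let 𝔤 be an s-step nilpotent Lie algebra and suppose that 𝔭 ⊆ 𝔤 is a progression of dimension k, with nilcompletion 𝔭̄. Then there is a progression 𝔮 ⊆ 𝔤 of dimension at most (4k)^s such that [𝔮, 𝔮] ⊆ (2k)^{2s} 𝔮 (the (2k)^{2s}-fold sumset of 𝔮) and 𝔭̄ ⊆ 𝔮 ⊆ (2k)^s 𝔭̄ (the (2k)^s-fold sumset of 𝔭̄). -/
/-- Shapes of iterated commutators. -/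
inductive CommShape : Type
  | leaf : CommShape
  | node : CommShape → CommShape → CommShape
  deriving DecidableEq

/-- The order (number of entries) of an iterated-commutator shape. -/
def CommShape.order : CommShape → ℕ
  | .leaf => 1
  | .node a b => a.order + b.order

/-- The set of values of an iterated-commutator shape with entries from `b`. -/
def shapeSet {V : Type*} [LieRing V] (b : Set V) : CommShape → Set V
  | .leaf => b
  | .node u v => {z | ∃ x ∈ shapeSet b u, ∃ y ∈ shapeSet b v, z = ⁅x, y⁆}

/-- The nilcompletion `b̄` of `b`: the sumset `b + [b,b] + [b,[b,b]] + …`, the sum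
running over all iterated commutator shapes of order at most `s` (each occurring
exactly once). -/
def Nilcompletion {V : Type*} [LieRing V] (s : ℕ) (b : Set V) : Set V :=
  {v | ∃ l : List (CommShape × V), (l.map Prod.fst).Nodup ∧
    (∀ sh : CommShape, sh ∈ l.map Prod.fst ↔ sh.order ≤ s) ∧
    (∀ p ∈ l, p.2 ∈ shapeSet b p.1) ∧ v = (l.map Prod.snd).sum}

/-- The `m`-fold sumset `S + ⋯ + S`. -/
def nfoldSum {V : Type*} [AddCommMonoid V] (m : ℕ) (S : Set V) : Set V :=
  {v | ∃ f : Fin m → V, (∀ i, f i ∈ S) ∧ v = ∑ i, f i}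

/-- A generalised arithmetic progression `{l₁ x₁ + ⋯ + l_k x_k : |lᵢ| ≤ Lᵢ}` of
dimension `k`. -/
def AddProgression {V : Type*} [AddCommGroup V] {k : ℕ} (x : Fin k → V) (L : Fin k → ℕ) :
    Set V :=
  {v | ∃ l : Fin k → ℤ, (∀ i, |l i| ≤ (L i : ℤ)) ∧ v = ∑ i, l i • x i}

open Finset

namespace CommShape

theorem order_pos (σ : CommShape) : 0 < σ.order := by
  cases σ with
  | leaf => exact Nat.one_pos
  | node u v => exact Nat.add_pos_left (order_pos u) _

theorem exists_finset_order_eq (n : ℕ) :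
    ∃ F : Finset CommShape, (∀ σ, σ ∈ F ↔ σ.order = n + 1) ∧ #F ≤ catalan n := by
  classical
  induction n using Nat.strong_induction_on with
  | _ n ih =>
    cases n with
    | zero =>
      refine ⟨{leaf}, fun σ => ?_, by simp⟩
      cases σ with
      | leaf => simp [order]
      | node u v =>
        have := u.order_pos
        have := v.order_pos
        simp only [mem_singleton, reduceCtorEq, order, false_iff]
        omega
    | succ n =>
      choose! F hF hcard using ih
      refine ⟨(antidiagonal n).biUnion fun p => (F p.1 ×ˢ F p.2).image fun q => node q.1 q.2,
        fun σ => ?_, ?_⟩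
      · cases σ with
        | leaf => simp [order]
        | node u v =>
          have := u.order_pos
          have := v.order_pos
          simp only [mem_biUnion, HasAntidiagonal.mem_antidiagonal, mem_image, mem_product, order, node.injEq,
            Prod.exists]
          constructor
          · rintro ⟨i, j, hij, a, b, ⟨ha, hb⟩, rfl, rfl⟩
            rw [hF i (by omega)] at ha
            rw [hF j (by omega)] at hb
            omega
          · intro h
            exact ⟨u.order - 1, v.order - 1, by omega, u, v,
              ⟨(hF _ (by omega) _).2 (by omega), (hF _ (by omega) _).2 (by omega)⟩, rfl, rfl⟩
      · rw [catalan_succ']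
        refine card_biUnion_le.trans (sum_le_sum fun p hp => card_image_le.trans ?_)
        rw [HasAntidiagonal.mem_antidiagonal] at hp
        rw [card_product]
        exact Nat.mul_le_mul (hcard _ (by omega)) (hcard _ (by omega))

theorem _root_.catalan_le_four_pow (n : ℕ) : catalan n ≤ 4 ^ n := by
  rw [catalan_eq_centralBinom_div]
  exact (Nat.div_le_self _ _).trans (Nat.centralBinom_le_four_pow n)

theorem _root_.sum_catalan_mul_pow_le {k : ℕ} (hk : 1 ≤ k) (s : ℕ) :
    ∑ n ∈ range s, catalan n * k ^ (n + 1) ≤ (4 * k) ^ s := by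
  induction s with
  | zero => simp
  | succ s ih =>
    rw [sum_range_succ]
    have h : catalan s * k ^ (s + 1) ≤ (4 * k) ^ s * k := by
      rw [mul_pow, mul_assoc, ← pow_succ]
      exact Nat.mul_le_mul_right _ (catalan_le_four_pow s)
    have h' : (4 * k) ^ s ≤ (4 * k) ^ s * k := Nat.le_mul_of_pos_right _ hk
    calc _ ≤ (4 * k) ^ s * k + (4 * k) ^ s * k := add_le_add (ih.trans h') h
      _ ≤ (4 * k) ^ (s + 1) := by rw [pow_succ]; linarith [Nat.zero_le ((4 * k) ^ s * k)]

/-- The shapes of order at most `s`, with a bound on the total number of ways of filling them with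
entries from a set of size `k`. -/
theorem exists_finset_order_le {k : ℕ} (hk : 1 ≤ k) (s : ℕ) :
    ∃ F : Finset CommShape, (∀ σ, σ ∈ F ↔ σ.order ≤ s) ∧
      ∑ σ ∈ F, k ^ σ.order ≤ (4 * k) ^ s := by
  classical
  choose F hF hcard using exists_finset_order_eq
  refine ⟨(range s).biUnion F, fun σ => ?_, ?_⟩
  · have := σ.order_pos
    simp only [mem_biUnion, mem_range, hF]
    exact ⟨by rintro ⟨n, hn, h⟩; omega, fun h => ⟨σ.order - 1, by omega, by omega⟩⟩
  · rw [sum_biUnion]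
    · refine (sum_le_sum fun n _ => ?_).trans (sum_catalan_mul_pow_le hk s)
      rw [sum_congr rfl fun σ hσ => by rw [(hF n σ).1 hσ], sum_const, smul_eq_mul]
      exact Nat.mul_le_mul_right _ (hcard n)
    · intro m _ n _ hmn
      refine disjoint_left.2 fun σ hm hn => hmn ?_
      rw [hF] at hm hn
      omega

end CommShape

section nfoldSum

variable {V : Type*} [AddCommMonoid V] {S : Set V}

theorem zero_mem_nfoldSum (h0 : (0 : V) ∈ S) (m : ℕ) : (0 : V) ∈ nfoldSum m S :=
  ⟨0, fun _ => h0, by simp⟩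

theorem subset_nfoldSum_one : S ⊆ nfoldSum 1 S := fun v hv => ⟨fun _ => v, fun _ => hv, by simp⟩

theorem add_mem_nfoldSum {m n : ℕ} {v w : V} (hv : v ∈ nfoldSum m S) (hw : w ∈ nfoldSum n S) :
    v + w ∈ nfoldSum (m + n) S := by
  obtain ⟨f, hf, rfl⟩ := hv
  obtain ⟨g, hg, rfl⟩ := hw
  refine ⟨Fin.append f g, fun i => ?_, by simp [Fin.sum_univ_add]⟩
  induction i using Fin.addCases with
  | left i => simpa using hf i
  | right i => simpa using hg i

theorem nfoldSum_subset_nfoldSum (h0 : (0 : V) ∈ S) {m n : ℕ} (hmn : m ≤ n) :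
    nfoldSum m S ⊆ nfoldSum n S := by
  intro v hv
  obtain ⟨d, rfl⟩ := Nat.exists_eq_add_of_le hmn
  simpa using add_mem_nfoldSum hv (zero_mem_nfoldSum h0 d)

theorem sum_mem_nfoldSum {ι : Type*} (A : Finset ι) {g : ι → V} {m : ℕ}
    (h : ∀ t ∈ A, g t ∈ nfoldSum m S) : ∑ t ∈ A, g t ∈ nfoldSum (#A * m) S := by
  classical
  induction A using Finset.induction_on with
  | empty =>
    rw [card_empty, Nat.zero_mul]
    exact ⟨Fin.elim0, fun i => i.elim0, by simp⟩
  | insert a A ha ih =>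
    rw [sum_insert ha, card_insert_of_notMem ha, add_mul, one_mul, add_comm (g a)]
    exact add_mem_nfoldSum (ih fun t ht => h t (mem_insert_of_mem ht)) (h a (mem_insert_self _ _))

theorem map_mem_nfoldSum {W : Type*} [AddCommMonoid W] (φ : V →+ W) {T : Set W}
    (h : ∀ v ∈ S, φ v ∈ T) {m : ℕ} {v : V} (hv : v ∈ nfoldSum m S) : φ v ∈ nfoldSum m T := by
  obtain ⟨f, hf, rfl⟩ := hv
  exact ⟨fun i => φ (f i), fun i => h _ (hf i), map_sum _ _ _⟩

end nfoldSum

theorem mem_addProgression_equivFin {V ι : Type*} [AddCommGroup V] (U : Finset ι) (g : ι → V)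
    (w : ι → ℕ) (v : V) :
    v ∈ AddProgression (fun i => g (U.equivFin.symm i)) (fun i => w (U.equivFin.symm i)) ↔
      ∃ c : ι → ℤ, (∀ t, |c t| ≤ (w t : ℤ)) ∧ v = ∑ t ∈ U, c t • g t := by
  classical
  constructor
  · rintro ⟨l, hl, rfl⟩
    refine ⟨fun t => if h : t ∈ U then l (U.equivFin ⟨t, h⟩) else 0, fun t => ?_, ?_⟩
    · dsimp only
      split_ifs with h
      · simpa using hl (U.equivFin ⟨t, h⟩)
      · simp
    · rw [← sum_coe_sort U, ← U.equivFin.symm.sum_comp]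
      simp
  · rintro ⟨c, hc, rfl⟩
    refine ⟨fun i => c (U.equivFin.symm i), fun i => hc _, ?_⟩
    rw [U.equivFin.symm.sum_comp (fun t : U => c t • g t), sum_coe_sort U fun t => c t • g t]

theorem zero_mem_addProgression {V : Type*} [AddCommGroup V] {k : ℕ} (x : Fin k → V)
    (L : Fin k → ℕ) : (0 : V) ∈ AddProgression x L :=
  ⟨0, by simp, by simp⟩

theorem mem_nilcompletion_iff {V : Type*} [LieRing V] {s : ℕ} {b : Set V} {F : Finset CommShape}
    (hF : ∀ σ, σ ∈ F ↔ σ.order ≤ s) (v : V) :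
    v ∈ Nilcompletion s b ↔
      ∃ f : CommShape → V, (∀ σ ∈ F, f σ ∈ shapeSet b σ) ∧ v = ∑ σ ∈ F, f σ := by
  classical
  constructor
  · rintro ⟨l, hnd, hl, hmem, rfl⟩
    have hf : ∀ σ, ∃ p : CommShape × V, σ ∈ F → p ∈ l ∧ p.1 = σ := fun σ => by
      by_cases hσ : σ ∈ F
      · obtain ⟨p, hp⟩ := List.mem_map.1 ((hl σ).2 ((hF σ).1 hσ))
        exact ⟨p, fun _ => hp⟩
      · exact ⟨(σ, 0), fun h => absurd h hσ⟩
    choose f hf using hf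
    have hfin : F = (l.map Prod.fst).toFinset := by
      ext σ
      rw [List.mem_toFinset, hl, hF]
    refine ⟨fun σ => (f σ).2, fun σ hσ => ?_, ?_⟩
    · have := hmem _ (hf σ hσ).1
      rwa [(hf σ hσ).2] at this
    · rw [hfin, List.sum_toFinset _ hnd, List.map_map]
      refine congrArg List.sum (List.map_congr_left fun p hp => ?_)
      have hpF : p.1 ∈ F := by
        rw [hfin, List.mem_toFinset]
        exact List.mem_map_of_mem hp
      exact congrArg Prod.snd
        (List.inj_on_of_nodup_map hnd hp (hf _ hpF).1 (hf _ hpF).2.symm)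
  · rintro ⟨f, hf, rfl⟩
    have hfst : (F.toList.map fun σ => (σ, f σ)).map Prod.fst = F.toList := by
      simp [Function.comp_def]
    refine ⟨F.toList.map fun σ => (σ, f σ), ?_, ?_, ?_, ?_⟩
    · rw [hfst]
      exact F.nodup_toList
    · intro σ
      rw [hfst, mem_toList, hF]
    · intro p hp
      obtain ⟨σ, hσ, rfl⟩ := List.mem_map.1 hp
      exact hf σ (mem_toList.1 hσ)
    · rw [List.map_map]
      exact (sum_map_toList F f).symm

theorem zero_mem_shapeSet {V : Type*} [LieRing V] {b : Set V} (h0 : (0 : V) ∈ b)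
    (σ : CommShape) : (0 : V) ∈ shapeSet b σ := by
  induction σ with
  | leaf => exact h0
  | node u v hu hv => exact ⟨0, hu, 0, hv, by simp⟩

theorem LieModule.lie_mem_lowerCentralSeries_add {R L : Type*} [CommRing R] [LieRing L]
    [LieAlgebra R L] (i j : ℕ) {x y : L} (hx : x ∈ lowerCentralSeries R L L i)
    (hy : y ∈ lowerCentralSeries R L L j) : ⁅x, y⁆ ∈ lowerCentralSeries R L L (i + j + 1) := by
  have hlie (n : ℕ) (a z : L) (hz : z ∈ lowerCentralSeries R L L n) :
      ⁅a, z⁆ ∈ lowerCentralSeries R L L (n + 1) := by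
    rw [lowerCentralSeries_succ]
    exact LieSubmodule.lie_mem_lie (LieSubmodule.mem_top a) hz
  induction i generalizing j x y with
  | zero => simpa using hlie j x y hy
  | succ i ih =>
    rw [lowerCentralSeries_succ, ← LieSubmodule.mem_toSubmodule,
      LieSubmodule.lieIdeal_oper_eq_linear_span'] at hx
    induction hx using Submodule.span_induction with
    | mem x hx =>
      obtain ⟨a, -, c, hc, rfl⟩ := hx
      rw [lie_lie]
      refine sub_mem ?_ ?_
      · have := hlie _ a _ (ih j hc hy)
        rwa [show i + j + 1 + 1 = i + 1 + j + 1 by omega] at this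
      · have := ih (j + 1) hc (hlie _ a _ hy)
        rwa [show i + (j + 1) + 1 = i + 1 + j + 1 by omega] at this
    | zero => simp
    | add x x' _ _ hx hx' =>
      rw [add_lie]
      exact add_mem hx hx'
    | smul r x _ hx =>
      rw [smul_lie]
      exact SMulMemClass.smul_mem r hx

namespace FreeMagma

variable {ι V : Type*}

/-- The shape of a formal iterated commutator. -/
def shape : FreeMagma ι → CommShape
  | .of _ => .leaf
  | .mul a b => .node a.shape b.shape

/-- The value of a formal iterated commutator in a Lie ring. -/
def commutator [LieRing V] (x : ι → V) : FreeMagma ι → V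
  | .of i => x i
  | .mul a b => ⁅a.commutator x, b.commutator x⁆

/-- The product of the weights of the entries of a formal iterated commutator. -/
def weight (L : ι → ℕ) : FreeMagma ι → ℕ
  | .of i => L i
  | .mul a b => a.weight L * b.weight L

/-- The coefficients of the bracket of two combinations of formal iterated commutators. -/
def lieCoeff (c d : FreeMagma ι → ℤ) : FreeMagma ι → ℤ
  | .of _ => 0
  | .mul a b => c a * d b

/-- All ways of filling a given shape with entries from `ι`. -/
def ofShape (ι : Type*) [Fintype ι] [DecidableEq ι] : CommShape → Finset (FreeMagma ι)
  | .leaf => univ.image .of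
  | .node u v => (ofShape ι u ×ˢ ofShape ι v).image fun p => .mul p.1 p.2

theorem mul_injective :
    Function.Injective fun p : FreeMagma ι × FreeMagma ι => FreeMagma.mul p.1 p.2 := by
  rintro ⟨a, b⟩ ⟨c, d⟩ h
  injection h with hac hbd
  exact Prod.ext hac hbd

theorem mem_ofShape [Fintype ι] [DecidableEq ι] {σ : CommShape} {t : FreeMagma ι} :
    t ∈ ofShape ι σ ↔ t.shape = σ := by
  induction t using FreeMagma.rec generalizing σ with
  | of i => cases σ <;> simp [ofShape, shape]
  | mul a b ha hb =>
    cases σ with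
    | leaf => simp [ofShape, shape]
    | node u v =>
      exact (mul_injective.mem_finset_image (a := (a, b))).trans (by simp [shape, ha, hb])

theorem card_ofShape_le [Fintype ι] [DecidableEq ι] (σ : CommShape) :
    #(ofShape ι σ) ≤ Fintype.card ι ^ σ.order := by
  induction σ with
  | leaf => exact card_image_le.trans (by simp [CommShape.order])
  | node u v hu hv =>
    refine card_image_le.trans ?_
    rw [card_product, CommShape.order, pow_add]
    exact Nat.mul_le_mul hu hv

theorem weight_pos {L : ι → ℕ} (hL : ∀ i, 0 < L i) (t : FreeMagma ι) : 0 < t.weight L := by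
  induction t using FreeMagma.rec with
  | of i => exact hL i
  | mul a b ha hb => exact Nat.mul_pos ha hb

theorem abs_lieCoeff_le {L : ι → ℕ} {c d : FreeMagma ι → ℤ}
    (hc : ∀ t, |c t| ≤ (t.weight L : ℤ)) (hd : ∀ t, |d t| ≤ (t.weight L : ℤ)) (t : FreeMagma ι) :
    |lieCoeff c d t| ≤ (t.weight L : ℤ) := by
  cases t with
  | of i => simp [lieCoeff]
  | mul a b =>
    rw [lieCoeff, weight, abs_mul, Nat.cast_mul]
    exact mul_le_mul (hc a) (hd b) (abs_nonneg _) (Nat.cast_nonneg _)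

theorem commutator_mem_lowerCentralSeries (R : Type*) [CommRing R] [LieRing V] [LieAlgebra R V]
    (x : ι → V) (t : FreeMagma ι) :
    t.commutator x ∈ LieModule.lowerCentralSeries R V V (t.shape.order - 1) := by
  induction t using FreeMagma.rec with
  | of i => simp [shape, CommShape.order]
  | mul a b ha hb =>
    have hab := LieModule.lie_mem_lowerCentralSeries_add _ _ ha hb
    have := a.shape.order_pos
    have := b.shape.order_pos
    rwa [show a.shape.order - 1 + (b.shape.order - 1) + 1 = (mul a b).shape.order - 1 by
      simp only [shape, CommShape.order]; omega] at hab

theorem commutator_eq_zero (R : Type*) [CommRing R] [LieRing V] [LieAlgebra R V] {s : ℕ}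
    (hs : LieModule.lowerCentralSeries R V V s = ⊥) (x : ι → V) {t : FreeMagma ι}
    (ht : s < t.shape.order) : t.commutator x = 0 := by
  have h := LieModule.antitone_lowerCentralSeries R V V (Nat.le_sub_one_of_lt ht)
    (t.commutator_mem_lowerCentralSeries R x)
  rwa [hs, LieSubmodule.mem_bot] at h

theorem lie_sum_sum_eq_sum_image [LieRing V] [DecidableEq ι] (x : ι → V)
    (A B : Finset (FreeMagma ι)) (c d : FreeMagma ι → ℤ) :
    ⁅∑ t ∈ A, c t • t.commutator x, ∑ t ∈ B, d t • t.commutator x⁆ =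
      ∑ t ∈ (A ×ˢ B).image fun p => mul p.1 p.2, lieCoeff c d t • t.commutator x := by
  rw [sum_image mul_injective.injOn, sum_product, _root_.sum_lie_sum]
  refine sum_congr rfl fun a _ => sum_congr rfl fun b _ => ?_
  rw [lieCoeff, commutator, zsmul_lie, lie_zsmul, mul_smul]

/-- The formal iterated commutators of order at most `s` span a subring of an `s`-step nilpotent
Lie ring, with explicit structure constants. -/
theorem lie_sum_sum_eq_sum [LieRing V] (R : Type*) [CommRing R] [LieAlgebra R V] {s : ℕ}
    (hs : LieModule.lowerCentralSeries R V V s = ⊥) (x : ι → V) {U : Finset (FreeMagma ι)}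
    (hU : ∀ t, t ∈ U ↔ t.shape.order ≤ s) (c d : FreeMagma ι → ℤ) :
    ⁅∑ t ∈ U, c t • t.commutator x, ∑ t ∈ U, d t • t.commutator x⁆ =
      ∑ t ∈ U, lieCoeff c d t • t.commutator x := by
  classical
  rw [lie_sum_sum_eq_sum_image]
  set M := (U ×ˢ U).image fun p => mul p.1 p.2 with hM
  rw [sum_subset (subset_union_left : M ⊆ M ∪ U), sum_subset (subset_union_right : U ⊆ M ∪ U)]
  · intro t _ ht
    rw [hU, not_le] at ht
    rw [commutator_eq_zero R hs x ht, smul_zero]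
  · intro t htU ht
    cases t with
    | of i => simp [lieCoeff]
    | mul a b =>
      have hab := (hU _).1 ((mem_union.1 htU).resolve_left ht)
      rw [shape, CommShape.order] at hab
      exact absurd (mem_image.2 ⟨(a, b), mem_product.2
        ⟨(hU a).2 (by omega), (hU b).2 (by omega)⟩, rfl⟩) ht

variable {k : ℕ}

theorem zsmul_mem_addProgression [AddCommGroup V] (x : Fin k → V) {L : Fin k → ℕ} (i : Fin k)
    {n : ℤ} (hn : |n| ≤ L i) : n • x i ∈ AddProgression x L := by
  refine ⟨Pi.single i n, fun j => ?_, ?_⟩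
  · obtain rfl | hj := eq_or_ne j i
    · simpa using hn
    · simp [hj]
  · rw [Fintype.sum_eq_single i fun j hj => by simp [hj]]
    simp

theorem weight_zsmul_commutator_mem_shapeSet [LieRing V] (x : Fin k → V) (L : Fin k → ℕ)
    (t : FreeMagma (Fin k)) :
    (t.weight L : ℤ) • t.commutator x ∈ shapeSet (AddProgression x L) t.shape := by
  induction t using FreeMagma.rec with
  | of i => exact zsmul_mem_addProgression x i (by simp [weight])
  | mul a b ha hb =>
    refine ⟨_, ha, _, hb, ?_⟩
    rw [weight, commutator, zsmul_lie, lie_zsmul, Nat.cast_mul, mul_smul]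

theorem commutator_mem_shapeSet [LieRing V] (x : Fin k → V) {L : Fin k → ℕ} (hL : ∀ i, 0 < L i)
    (t : FreeMagma (Fin k)) : t.commutator x ∈ shapeSet (AddProgression x L) t.shape := by
  induction t using FreeMagma.rec with
  | of i =>
    rw [← one_zsmul (commutator x _)]
    exact zsmul_mem_addProgression x i (by simpa using Nat.succ_le_of_lt (hL i))
  | mul a b ha hb => exact ⟨_, ha, _, hb, rfl⟩

/-- Splitting coefficients by mixed radix expansion with respect to the weights of the entries. -/
theorem zsmul_commutator_mem_nfoldSum [LieRing V] (x : Fin k → V) {L : Fin k → ℕ}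
    (hL : ∀ i, 0 < L i) (t : FreeMagma (Fin k)) {n : ℤ} (hn : |n| ≤ (t.weight L : ℤ)) :
    n • t.commutator x ∈
      nfoldSum t.shape.order (shapeSet (AddProgression x L) t.shape) := by
  induction t using FreeMagma.rec generalizing n with
  | of i => exact subset_nfoldSum_one (zsmul_mem_addProgression x i hn)
  | mul a b ha hb =>
    set P : ℤ := (b.weight L : ℤ) with hP
    have hP0 : 0 < P := Nat.cast_pos.2 (b.weight_pos hL)
    rw [weight, Nat.cast_mul, ← hP] at hn
    obtain ⟨hn₁, hn₂⟩ := abs_le.1 hn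
    have hq : |n / P| ≤ (a.weight L : ℤ) := by
      refine abs_le.2 ⟨(Int.le_ediv_iff_mul_le hP0).2 (by linarith), ?_⟩
      exact Int.ediv_le_of_le_mul hP0 hn₂
    have hr : |n % P| ≤ P := by
      rw [abs_of_nonneg (Int.emod_nonneg _ hP0.ne')]
      exact (Int.emod_lt_of_pos _ hP0).le
    have h : n • (mul a b).commutator x =
        ⁅(n / P) • a.commutator x, P • b.commutator x⁆ +
          ⁅a.commutator x, (n % P) • b.commutator x⁆ := by
      conv_lhs => rw [← Int.ediv_mul_add_emod n P]
      rw [commutator, add_smul, mul_smul, zsmul_lie, lie_zsmul, lie_zsmul]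
    rw [h]
    refine add_mem_nfoldSum
      (map_mem_nfoldSum ((LieRingModule.toEnd V V).flip (P • b.commutator x)) ?_ (ha hq))
      (map_mem_nfoldSum (LieRingModule.toEnd V V (a.commutator x)) ?_ (hb hr))
    · exact fun v hv => ⟨v, hv, _, b.weight_zsmul_commutator_mem_shapeSet x L, rfl⟩
    · exact fun v hv => ⟨_, a.commutator_mem_shapeSet x hL, v, hv, rfl⟩

theorem exists_eq_sum_of_mem_shapeSet [LieRing V] (x : Fin k → V) (L : Fin k → ℕ) (σ : CommShape)
    {v : V} (hv : v ∈ shapeSet (AddProgression x L) σ) :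
    ∃ c : FreeMagma (Fin k) → ℤ, (∀ t, |c t| ≤ (t.weight L : ℤ)) ∧
      v = ∑ t ∈ ofShape (Fin k) σ, c t • t.commutator x := by
  induction σ generalizing v with
  | leaf =>
    obtain ⟨l, hl, rfl⟩ := hv
    refine ⟨fun | .of i => l i | .mul _ _ => 0, fun t => ?_, ?_⟩
    · cases t with
      | of i => exact hl i
      | mul a b => simp
    · rw [ofShape, sum_image fun i _ j _ h => by injection h]
      rfl
  | node σ τ hσ hτ =>
    obtain ⟨a, ha, b, hb, rfl⟩ := hv
    obtain ⟨c, hc, rfl⟩ := hσ ha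
    obtain ⟨d, hd, rfl⟩ := hτ hb
    exact ⟨lieCoeff c d, abs_lieCoeff_le hc hd, lie_sum_sum_eq_sum_image x _ _ c d⟩

theorem sum_ofShape_mem_nfoldSum [LieRing V] (x : Fin k → V) {L : Fin k → ℕ}
    (hL : ∀ i, 0 < L i) {c : FreeMagma (Fin k) → ℤ} (hc : ∀ t, |c t| ≤ (t.weight L : ℤ))
    (σ : CommShape) :
    ∑ t ∈ ofShape (Fin k) σ, c t • t.commutator x ∈
      nfoldSum ((2 * k) ^ σ.order) (shapeSet (AddProgression x L) σ) := by
  refine nfoldSum_subset_nfoldSum (zero_mem_shapeSet (zero_mem_addProgression x L) σ) ?_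
    (sum_mem_nfoldSum (m := σ.order) _ fun t ht => ?_)
  · have h := card_ofShape_le (ι := Fin k) σ
    rw [Fintype.card_fin] at h
    rw [mul_pow, mul_comm]
    exact Nat.mul_le_mul Nat.lt_two_pow_self.le h
  · rw [← mem_ofShape.1 ht]
    exact zsmul_commutator_mem_nfoldSum x hL t (hc t)

end FreeMagma

/-- The nilcompletion of a progression `𝔭` of dimension `k` in an `s`-step nilpotent
Lie algebra is trapped between a progression `𝔮` of dimension at most `(4k)^s` with
`[𝔮,𝔮] ⊆ (2k)^{2s} 𝔮` and the corresponding sumsets: `𝔭̄ ⊆ 𝔮 ⊆ (2k)^s 𝔭̄`. -/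
theorem stmt10 (s : ℕ) (hs : 1 ≤ s) (𝔤 : Type) [LieRing 𝔤] [LieAlgebra ℝ 𝔤]
    (hstep : LieModule.lowerCentralSeries ℝ 𝔤 𝔤 s = ⊥)
    (k : ℕ) (hk : 1 ≤ k) (x : Fin k → 𝔤) (L : Fin k → ℕ) (hL : ∀ i, 0 < L i) :
    ∃ (k' : ℕ) (y : Fin k' → 𝔤) (L' : Fin k' → ℕ),
      (∀ i, 0 < L' i) ∧ k' ≤ (4 * k) ^ s ∧
      (∀ a ∈ AddProgression y L', ∀ b ∈ AddProgression y L',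
        ⁅a, b⁆ ∈ nfoldSum ((2 * k) ^ (2 * s)) (AddProgression y L')) ∧
      Nilcompletion s (AddProgression x L) ⊆ AddProgression y L' ∧
      AddProgression y L' ⊆ nfoldSum ((2 * k) ^ s) (Nilcompletion s (AddProgression x L)) := by
  classical
  obtain ⟨F, hF, hcard⟩ := CommShape.exists_finset_order_le hk s
  set U : Finset (FreeMagma (Fin k)) := F.biUnion (FreeMagma.ofShape (Fin k)) with hUdef
  have hU (t : FreeMagma (Fin k)) : t ∈ U ↔ t.shape.order ≤ s := by
    simp [hUdef, FreeMagma.mem_ofShape, hF]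
  have hsum (g : FreeMagma (Fin k) → 𝔤) :
      ∑ t ∈ U, g t = ∑ σ ∈ F, ∑ t ∈ FreeMagma.ofShape (Fin k) σ, g t := by
    refine sum_biUnion fun σ _ τ _ hστ => disjoint_left.2 fun t hσ hτ => hστ ?_
    exact (FreeMagma.mem_ofShape.1 hσ).symm.trans (FreeMagma.mem_ofShape.1 hτ)
  have hmem := mem_addProgression_equivFin U (fun t => t.commutator x) (fun t => t.weight L)
  refine ⟨#U, fun i => (U.equivFin.symm i : FreeMagma (Fin k)).commutator x,
    fun i => (U.equivFin.symm i : FreeMagma (Fin k)).weight L,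
    fun i => FreeMagma.weight_pos hL _, ?_, ?_, ?_, ?_⟩
  · refine (card_biUnion_le.trans (sum_le_sum fun σ _ => ?_)).trans hcard
    simpa using FreeMagma.card_ofShape_le (ι := Fin k) σ
  · intro a ha b hb
    have h1 : 1 ≤ (2 * k) ^ (2 * s) := Nat.one_le_pow _ _ (by omega)
    refine nfoldSum_subset_nfoldSum (zero_mem_addProgression _ _) h1
      (subset_nfoldSum_one ((hmem _).2 ?_))
    obtain ⟨c, hc, rfl⟩ := (hmem a).1 ha
    obtain ⟨d, hd, rfl⟩ := (hmem b).1 hb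
    exact ⟨_, FreeMagma.abs_lieCoeff_le hc hd, FreeMagma.lie_sum_sum_eq_sum ℝ hstep x hU c d⟩
  · intro v hv
    obtain ⟨f, hf, rfl⟩ := (mem_nilcompletion_iff hF v).1 hv
    choose! c hc hfc using fun σ hσ => FreeMagma.exists_eq_sum_of_mem_shapeSet x L σ (hf σ hσ)
    refine (hmem _).2 ⟨fun t => if t ∈ U then c t.shape t else 0, fun t => ?_, ?_⟩
    · dsimp only
      split_ifs with ht
      · exact hc _ ((hF _).2 ((hU t).1 ht)) t
      · simp
    · rw [hsum]
      refine sum_congr rfl fun σ hσ => (hfc σ hσ).trans (sum_congr rfl fun t ht => ?_)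
      have htU : t ∈ U := mem_biUnion.2 ⟨σ, hσ, ht⟩
      simp only [if_pos htU, FreeMagma.mem_ofShape.1 ht]
  · intro v hv
    obtain ⟨c, hc, rfl⟩ := (hmem v).1 hv
    rw [hsum]
    have hσ (σ : CommShape) (hσ : σ ∈ F) :
        ∑ t ∈ FreeMagma.ofShape (Fin k) σ, c t • t.commutator x ∈
          nfoldSum ((2 * k) ^ s) (shapeSet (AddProgression x L) σ) :=
      nfoldSum_subset_nfoldSum (zero_mem_shapeSet (zero_mem_addProgression x L) σ)
        (Nat.pow_le_pow_right (by omega) ((hF σ).1 hσ))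
        (FreeMagma.sum_ofShape_mem_nfoldSum x hL hc σ)
    choose! f hf hfc using hσ
    refine ⟨fun i => ∑ σ ∈ F, f σ i, fun i => (mem_nilcompletion_iff hF _).2
      ⟨fun σ => f σ i, fun σ hσ => hf σ hσ i, rfl⟩, ?_⟩
    rw [sum_comm]
    exact sum_congr rfl hfc
end

section
/- There is an absolute constant C with the following property. Let m ≥ 1, let K ≥ 1, and suppose that X is a finite K-approximate subgroup of ℝ^m. Then there is a progression P = {l_1 x_1 + … + l_k x_k : l_i ∈ ℤ, |l_i| ≤ L_i}, with x_1, …, x_k ∈ ℝ^m, positive integers L_1, …, L_k, and k ≤ K^C, such that X ⊆ P and P ⊆ NX for some positive integer N ≤ K^C, where NX denotes the N-fold sumset X + … + X. -/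
open Pointwise

/-- A finite subset `A` of an additive group is a `K`-approximate group: it is symmetric,
contains `0`, and `A + A ⊆ X + A` for some symmetric `X ⊆ A + A` with `|X| ≤ K`. -/
def IsAddApproxGroup {G : Type*} [AddCommGroup G] (K : ℝ) (A : Set G) : Prop :=
  (∀ a ∈ A, -a ∈ A) ∧ (0 : G) ∈ A ∧
    ∃ X : Set G, X.Finite ∧ (∀ x ∈ X, -x ∈ X) ∧ X ⊆ A + A ∧
      (X.ncard : ℝ) ≤ K ∧ A + A ⊆ X + A

theorem sum_stdAddChar_mul (N : ℕ) [NeZero N] (x : ZMod N) :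
    ∑ r : ZMod N, ZMod.stdAddChar (r * x) = if x = 0 then (N : ℂ) else 0 := by
  rw [AddChar.sum_mulShift x (ZMod.isPrimitive_stdAddChar N), ZMod.card]
  split_ifs <;> simp

/-- **Bogolyubov's lemma** in `ZMod N`. -/
theorem exists_bohr_subset_two_sub_two (N D : ℕ) [NeZero N] (A : Finset (ZMod N))
    (hA : A.Nonempty) (hD : N ≤ D * A.card) :
    ∃ Γ : Finset (ZMod N), Γ.card ≤ 2 * D ^ 2 ∧
      ∀ x : ZMod N, (∀ r ∈ Γ, 0 ≤ (ZMod.stdAddChar (r * x) : ℂ).re) →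
        ∃ a ∈ A, ∃ b ∈ A, ∃ c ∈ A, ∃ d ∈ A, x = a + b - c - d := by
  classical
  set F : ZMod N → ℂ := fun r => ∑ a ∈ A, ZMod.stdAddChar (r * a) with hF
  have hconj (r : ZMod N) : (starRingEnd ℂ) (F r) = ∑ a ∈ A, ZMod.stdAddChar (-(r * a)) := by
    simp [hF, map_sum, AddChar.map_neg_eq_conj]
  have hsq (r : ZMod N) : ((‖F r‖ ^ 2 : ℝ) : ℂ) =
      ∑ a ∈ A, ∑ c ∈ A, ZMod.stdAddChar (r * (a - c)) := by
    rw [← Complex.normSq_eq_norm_sq, ← Complex.mul_conj, hconj, hF, Finset.sum_mul_sum]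
    refine Finset.sum_congr rfl fun a _ => Finset.sum_congr rfl fun c _ => ?_
    rw [← AddChar.map_add_eq_mul]; congr 1; ring
  have hparseval : ∑ r, ‖F r‖ ^ 2 = N * A.card := by
    have : ((∑ r, ‖F r‖ ^ 2 : ℝ) : ℂ) = ((N * A.card : ℝ) : ℂ) := by
      rw [Complex.ofReal_sum]
      simp_rw [hsq]
      rw [Finset.sum_comm]
      simp_rw [Finset.sum_comm (s := Finset.univ) (t := A), sum_stdAddChar_mul, sub_eq_zero]
      simp [Finset.sum_ite_eq, mul_comm]
    exact_mod_cast this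
  have hAc : (0 : ℝ) < A.card := by exact_mod_cast hA.card_pos
  have hN : (0 : ℝ) < N := by exact_mod_cast NeZero.pos N
  have hD' : (N : ℝ) ≤ D * A.card := by exact_mod_cast hD
  have hD0 : (0 : ℝ) < D := by
    by_contra h
    have : (D : ℝ) * A.card ≤ 0 := mul_nonpos_of_nonpos_of_nonneg (not_lt.1 h) hAc.le
    linarith
  set Γ : Finset (ZMod N) := {r | (A.card : ℝ) ^ 2 ≤ 2 * D * ‖F r‖ ^ 2} with hΓ
  refine ⟨Γ, ?_, fun x hx => ?_⟩
  · have h1 : (Γ.card : ℝ) * A.card ^ 2 ≤ 2 * D * (N * A.card) := by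
      rw [← hparseval, Finset.mul_sum, ← nsmul_eq_mul, ← Finset.sum_const]
      refine (Finset.sum_le_sum fun r hr => (Finset.mem_filter.1 hr).2).trans ?_
      exact Finset.sum_le_sum_of_subset_of_nonneg (Finset.subset_univ _)
        fun _ _ _ => by positivity
    have h2 : (Γ.card : ℝ) * A.card ^ 2 ≤ (2 * D ^ 2) * A.card ^ 2 := by
      nlinarith [mul_le_mul_of_nonneg_left hD' (by positivity : 0 ≤ 2 * (D : ℝ) * A.card)]
    have := le_of_mul_le_mul_right h2 (by positivity)
    exact_mod_cast this
  · by_contra hrep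
    have hzero : ∑ r, ((‖F r‖ ^ 2 * ‖F r‖ ^ 2 : ℝ) : ℂ) * ZMod.stdAddChar (r * x) = 0 := by
      have (r : ZMod N) : ((‖F r‖ ^ 2 * ‖F r‖ ^ 2 : ℝ) : ℂ) * ZMod.stdAddChar (r * x) =
          ∑ p ∈ (A ×ˢ A) ×ˢ (A ×ˢ A),
            ZMod.stdAddChar (r * ((p.1.1 - p.1.2) + (p.2.1 - p.2.2) + x)) := by
        rw [Complex.ofReal_mul, hsq, ← Finset.sum_product', Finset.sum_mul_sum,
          ← Finset.sum_product', Finset.sum_mul]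
        refine Finset.sum_congr rfl fun p _ => ?_
        rw [← AddChar.map_add_eq_mul, ← AddChar.map_add_eq_mul]; congr 1; ring
      simp_rw [this]
      rw [Finset.sum_comm]
      simp_rw [sum_stdAddChar_mul]
      refine Finset.sum_eq_zero fun p hp => if_neg fun h => hrep ?_
      simp only [Finset.mem_product] at hp
      exact ⟨p.1.2, hp.1.2, p.2.2, hp.2.2, p.1.1, hp.1.1, p.2.1, hp.2.1, by linear_combination h⟩
    have hre : ∑ r, ‖F r‖ ^ 2 * ‖F r‖ ^ 2 * (ZMod.stdAddChar (r * x) : ℂ).re = 0 := by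
      have := congrArg Complex.re hzero
      rw [Complex.re_sum] at this
      simpa only [Complex.re_ofReal_mul, Complex.zero_re] using this
    rw [← Finset.sum_add_sum_compl Γ] at hre
    have hF0 : F 0 = A.card := by simp [hF]
    have h0 : (0 : ZMod N) ∈ Γ := by
      simp only [hΓ, Finset.mem_filter, Finset.mem_univ, true_and, hF0, Complex.norm_natCast]
      have : (1 : ℝ) ≤ D := by exact_mod_cast Nat.one_le_iff_ne_zero.2 (by rintro rfl; simp at hD0)
      nlinarith [sq_nonneg (A.card : ℝ)]
    have hbig : (A.card : ℝ) ^ 4 ≤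
        ∑ r ∈ Γ, ‖F r‖ ^ 2 * ‖F r‖ ^ 2 * (ZMod.stdAddChar (r * x) : ℂ).re := by
      refine le_trans (le_of_eq ?_) (Finset.single_le_sum
        (fun r hr => mul_nonneg (by positivity) (hx r hr)) h0)
      simp [hF0]; ring
    have hsmall : -((A.card : ℝ) ^ 4 / 2) ≤
        ∑ r ∈ Γᶜ, ‖F r‖ ^ 2 * ‖F r‖ ^ 2 * (ZMod.stdAddChar (r * x) : ℂ).re := by
      have hterm : ∀ r ∈ Γᶜ, -((A.card : ℝ) ^ 2 / (2 * D) * ‖F r‖ ^ 2) ≤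
          ‖F r‖ ^ 2 * ‖F r‖ ^ 2 * (ZMod.stdAddChar (r * x) : ℂ).re := by
        intro r hr
        have h1 : ‖F r‖ ^ 2 ≤ (A.card : ℝ) ^ 2 / (2 * D) := by
          simp only [hΓ, Finset.mem_compl, Finset.mem_filter, Finset.mem_univ, true_and,
            not_le] at hr
          rw [le_div_iff₀ (by positivity)]; linarith
        have h2 : -1 ≤ (ZMod.stdAddChar (r * x) : ℂ).re := by
          have := Complex.abs_re_le_norm (ZMod.stdAddChar (r * x) : ℂ)
          rw [AddChar.norm_apply] at this
          exact (abs_le.1 this).1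
        have h3 : 0 ≤ ‖F r‖ ^ 2 := by positivity
        nlinarith [mul_le_mul_of_nonneg_right h1 h3, mul_nonneg h3 h3]
      refine le_trans ?_ (Finset.sum_le_sum hterm)
      rw [Finset.sum_neg_distrib, ← Finset.mul_sum, neg_le_neg_iff]
      have : ∑ r ∈ Γᶜ, ‖F r‖ ^ 2 ≤ N * A.card := by
        rw [← hparseval]
        exact Finset.sum_le_sum_of_subset_of_nonneg (Finset.subset_univ _)
          fun _ _ _ => by positivity
      calc (A.card : ℝ) ^ 2 / (2 * D) * ∑ r ∈ Γᶜ, ‖F r‖ ^ 2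
          ≤ (A.card : ℝ) ^ 2 / (2 * D) * (D * A.card * A.card) := by gcongr; nlinarith
        _ = (A.card : ℝ) ^ 4 / 2 := by field_simp
    have : (0 : ℝ) < (A.card : ℝ) ^ 4 := by positivity
    linarith

/-- Successive minima of a lattice, together with an orthonormal basis adapted to them. -/
theorem exists_successive_minima {E : Type*} [NormedAddCommGroup E] [InnerProductSpace ℝ E]
    [FiniteDimensional ℝ E] {d : ℕ} (hfin : Module.finrank ℝ E = d) (Λ : AddSubgroup E) {M : ℝ}
    (hM : 0 < M) (hq : ∀ v ∈ Λ, ∃ n : ℕ, M * ‖v‖ ^ 2 = n)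
    (hfull : ∀ S : Submodule ℝ E, S ≠ ⊤ → ∃ v ∈ Λ, v ∉ S ∧ ‖v‖ ≤ 1) :
    ∃ (v : Fin d → E) (b : OrthonormalBasis (Fin d) ℝ E),
      (∀ i, v i ∈ Λ) ∧ LinearIndependent ℝ v ∧ (∀ i, ‖v i‖ ≤ 1) ∧
      ∀ w ∈ Λ, (∀ i, |inner ℝ (b i) w| * (2 * d) ≤ ‖v i‖) → w = 0 := by
  classical
  have step (S : Submodule ℝ E) : ∃ w : E, S ≠ ⊤ →
      w ∈ Λ ∧ w ∉ S ∧ ‖w‖ ≤ 1 ∧ ∀ w' ∈ Λ, w' ∉ S → ‖w‖ ≤ ‖w'‖ := by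
    by_cases hS : S = ⊤
    · exact ⟨0, fun h => (h hS).elim⟩
    obtain ⟨u, huΛ, huS, hu1⟩ := hfull S hS
    choose! q hq using hq
    obtain ⟨w, ⟨hwΛ, hwS⟩, hmin⟩ := (measure q).wf.has_min {w | w ∈ Λ ∧ w ∉ S} ⟨u, huΛ, huS⟩
    have hle : ∀ w' ∈ Λ, w' ∉ S → ‖w‖ ≤ ‖w'‖ := by
      intro w' hw' hw'S
      have h1 : q w ≤ q w' := not_lt.1 (hmin w' ⟨hw', hw'S⟩)
      have h2 : M * ‖w‖ ^ 2 ≤ M * ‖w'‖ ^ 2 := by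
        rw [hq w hwΛ, hq w' hw']
        exact_mod_cast h1
      exact (sq_le_sq₀ (norm_nonneg _) (norm_nonneg _)).1 (le_of_mul_le_mul_left h2 hM)
    exact ⟨w, fun _ => ⟨hwΛ, hwS, (hle _ huΛ huS).trans hu1, hle⟩⟩
  choose g hg using step
  obtain ⟨S, hS0, hSsucc⟩ : ∃ S : ℕ → Submodule ℝ E, S 0 = ⊥ ∧
      ∀ n, S (n + 1) = S n ⊔ Submodule.span ℝ {g (S n)} :=
    ⟨fun n => Nat.rec ⊥ (fun _ T => T ⊔ Submodule.span ℝ {g T}) n, rfl, fun _ => rfl⟩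
  have hmono : Monotone S := monotone_nat_of_le_succ fun n => by rw [hSsucc]; exact le_sup_left
  have hgS (n : ℕ) : g (S n) ∈ S (n + 1) := by
    rw [hSsucc]
    exact Submodule.mem_sup_right (Submodule.mem_span_singleton_self _)
  have hrank (n : ℕ) : Module.finrank ℝ ↥(S n) ≤ n := by
    induction n with
    | zero => simp [hS0]
    | succ n ih =>
      rw [hSsucc]
      refine (Submodule.finrank_add_le_finrank_add_finrank _ _).trans ?_
      exact add_le_add ih ((finrank_span_le_card _).trans (by simp))
  have hne {n : ℕ} (hn : n < d) : S n ≠ ⊤ := by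
    intro h
    have := hrank n
    rw [h, finrank_top, hfin] at this
    omega
  have hrank' {n : ℕ} (hn : n ≤ d) : n ≤ Module.finrank ℝ ↥(S n) := by
    induction n with
    | zero => simp
    | succ n ih =>
      have hlt : S n < S (n + 1) := by
        exact SetLike.lt_iff_le_and_exists.2
          ⟨hmono n.le_succ, _, hgS n, (hg (S n) (hne hn)).2.1⟩
      have := Submodule.finrank_lt_finrank_of_lt hlt
      have := ih (by omega)
      omega
  have htop : S d = ⊤ := Submodule.eq_top_of_finrank_eq
    (le_antisymm (Submodule.finrank_le _) (by rw [hfin]; exact hrank' le_rfl))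
  let v : Fin d → E := fun i => g (S i)
  have hspan {n : ℕ} (hn : n ≤ d) : S n ≤ Submodule.span ℝ (Set.range v) := by
    induction n with
    | zero => simp [hS0]
    | succ n ih =>
      rw [hSsucc, sup_le_iff, Submodule.span_singleton_le_iff_mem]
      exact ⟨ih (by omega), Submodule.subset_span ⟨⟨n, hn⟩, rfl⟩⟩
  have hli : LinearIndependent ℝ v := linearIndependent_of_top_le_span_of_card_eq_finrank
    (by rw [← htop]; exact hspan le_rfl) (by simp [hfin])
  have hvprop (i : Fin d) := hg (S i) (hne i.2)
  set b := InnerProductSpace.gramSchmidtOrthonormalBasis (𝕜 := ℝ) (ι := Fin d) (by simp [hfin]) v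
  have horth {n : ℕ} (j : Fin d) (hn : n ≤ j) {w : E} (hw : w ∈ S n) : inner ℝ (b j) w = 0 := by
    induction n generalizing w with
    | zero => simp only [hS0, Submodule.mem_bot] at hw; simp [hw]
    | succ n ih =>
      rw [hSsucc] at hw
      obtain ⟨y, hy, z, hz, rfl⟩ := Submodule.mem_sup.1 hw
      obtain ⟨c, rfl⟩ := Submodule.mem_span_singleton.1 hz
      have : inner ℝ (b j) (v ⟨n, by omega⟩) = 0 :=
        InnerProductSpace.gramSchmidtOrthonormalBasis_inv_triangular _ _ (Fin.lt_def.2 hn)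
      rw [inner_add_right, inner_smul_right, ih (by omega) hy]
      simp only [v] at this
      simp [this]
  refine ⟨v, b, fun i => (hvprop i).1, hli, fun i => (hvprop i).2.2.1, fun w hw hsmall => ?_⟩
  by_contra hw0
  have hexn : ∃ n, w ∈ S n := ⟨d, by simp [htop]⟩
  obtain ⟨k, hk⟩ : ∃ k, Nat.find hexn = k + 1 := by
    refine Nat.exists_eq_succ_of_ne_zero fun h => hw0 ?_
    have := Nat.find_spec hexn
    rw [h] at this
    simpa [hS0] using this
  have hkmem : w ∈ S (k + 1) := hk ▸ Nat.find_spec hexn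
  have hknot : w ∉ S k := Nat.find_min hexn (by omega)
  have hkd : k < d := by
    have : Nat.find hexn ≤ d := Nat.find_min' hexn (by simp [htop])
    omega
  have hle : ‖v ⟨k, hkd⟩‖ ≤ ‖w‖ := (hvprop ⟨k, hkd⟩).2.2.2 w hw hknot
  have hpos : 0 < ‖v ⟨k, hkd⟩‖ := norm_pos_iff.2 (hli.ne_zero _)
  have hd : (0 : ℝ) < d := by exact_mod_cast (by omega : 0 < d)
  have hcoord (i : Fin d) : |inner ℝ (b i) w| ≤ ‖v ⟨k, hkd⟩‖ / (2 * d) := by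
    by_cases hik : (i : ℕ) ≤ k
    · rw [le_div_iff₀ (by positivity)]
      refine (hsmall i).trans ((hvprop i).2.2.2 _ (hvprop ⟨k, hkd⟩).1 fun h => ?_)
      exact (hvprop ⟨k, hkd⟩).2.1 (hmono hik h)
    · rw [horth i (by omega) hkmem]
      simp only [abs_zero]
      positivity
  have : ‖w‖ ≤ ∑ i : Fin d, ‖v ⟨k, hkd⟩‖ / (2 * d) := by
    conv_lhs => rw [← b.sum_repr' w]
    refine (norm_sum_le _ _).trans (Finset.sum_le_sum fun i _ => ?_)
    rw [norm_smul, b.norm_eq_one, mul_one]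
    exact hcoord i
  rw [Finset.sum_const, Finset.card_univ, Fintype.card_fin, nsmul_eq_mul] at this
  have h2 : (d : ℝ) * (‖v ⟨k, hkd⟩‖ / (2 * d)) = ‖v ⟨k, hkd⟩‖ / 2 := by field_simp
  linarith

/-- The upper bound in Minkowski's second theorem, by the pigeonhole principle. -/
theorem card_mul_prod_norm_le {E : Type*} [NormedAddCommGroup E] [InnerProductSpace ℝ E]
    {d : ℕ} (hd : 0 < d) (Λ : AddSubgroup E)
    (v : Fin d → E)
    (b : OrthonormalBasis (Fin d) ℝ E) (hv0 : ∀ i, 0 < ‖v i‖)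
    (hv1 : ∀ i, ‖v i‖ ≤ 1)
    (h : ∀ w ∈ Λ, (∀ i, |inner ℝ (b i) w| * (2 * d) ≤ ‖v i‖) → w = 0)
    (W : Finset E) (hW : ∀ w ∈ W, ‖w‖ ≤ d)
    (hWΛ : ∀ w ∈ W, ∀ w' ∈ W, w - w' ∈ Λ) :
    (W.card : ℝ) * ∏ i, ‖v i‖ ≤ (7 * d ^ 2 : ℝ) ^ d := by
  classical
  have hd1 : (1 : ℝ) ≤ d := by exact_mod_cast hd
  let β : E → Fin d → ℤ :=
    fun w i => ⌊inner ℝ (b i) w * (2 * d) / ‖v i‖⌋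
  let T : Fin d → ℤ := fun i => ⌈2 * (d : ℝ) ^ 2 / ‖v i‖⌉
  have hinj : Set.InjOn β W := by
    intro w hw w' hw' hww'
    refine sub_eq_zero.1 (h _ (hWΛ w hw w' hw') fun i => ?_)
    have := Int.abs_sub_lt_one_of_floor_eq_floor (congrFun hww' i)
    rw [← sub_div, ← sub_mul, ← inner_sub_right, abs_div, abs_mul, abs_norm,
      abs_of_pos (by positivity : (0 : ℝ) < 2 * d), div_lt_one (hv0 i)] at this
    exact this.le
  have hmaps : ∀ w ∈ W, β w ∈ Fintype.piFinset fun i => Finset.Icc (-T i) (T i) := by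
    intro w hw
    rw [Fintype.mem_piFinset]
    intro i
    have h1 : |inner ℝ (b i) w * (2 * d) / ‖v i‖| ≤ 2 * (d : ℝ) ^ 2 / ‖v i‖ := by
      rw [abs_div, abs_mul, abs_norm, abs_of_pos (by positivity : (0 : ℝ) < 2 * d)]
      have h0 : |inner ℝ (b i) w| ≤ d := (abs_real_inner_le_norm (b i) w).trans
        (by rw [b.norm_eq_one, one_mul]; exact hW w hw)
      gcongr ?_ / _
      nlinarith
    have h2 := (abs_le.1 h1)
    have h3 := Int.le_ceil (2 * (d : ℝ) ^ 2 / ‖v i‖)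
    rw [Finset.mem_Icc]
    constructor
    · rw [Int.le_floor]
      push_cast
      linarith
    · exact Int.cast_le (R := ℝ).1 ((Int.floor_le _).trans (by linarith))
  have hcard := Finset.card_le_card_of_injOn β hmaps hinj
  rw [Fintype.card_piFinset] at hcard
  have hfac (i : Fin d) : ((Finset.Icc (-T i) (T i)).card : ℝ) * ‖v i‖ ≤ 7 * d ^ 2 := by
    have hT0 : 0 ≤ T i := Int.ceil_nonneg (by positivity)
    have hTlt : (T i : ℝ) < 2 * (d : ℝ) ^ 2 / ‖v i‖ + 1 := Int.ceil_lt_add_one _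
    have hc : ((Finset.Icc (-T i) (T i)).card : ℝ) = 2 * T i + 1 := by
      rw [Int.card_Icc]
      have : (((T i + 1 - -T i).toNat : ℤ) : ℝ) = ((T i + 1 - -T i : ℤ) : ℝ) := by
        rw [Int.toNat_of_nonneg (by omega)]
      rw [← Int.cast_natCast, this]
      push_cast
      ring
    rw [hc]
    have h4 : (T i : ℝ) * ‖v i‖ ≤ 2 * (d : ℝ) ^ 2 + ‖v i‖ := by
      have := mul_le_mul_of_nonneg_right hTlt.le (hv0 i).le
      rwa [add_mul, div_mul_cancel₀ _ (hv0 i).ne', one_mul] at this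
    nlinarith [hv1 i]
  calc (W.card : ℝ) * ∏ i, ‖v i‖
      ≤ (∏ i, ((Finset.Icc (-T i) (T i)).card : ℝ)) * ∏ i, ‖v i‖ := by
        gcongr
        exact_mod_cast hcard
    _ = ∏ i, ((Finset.Icc (-T i) (T i)).card : ℝ) * ‖v i‖ := Finset.prod_mul_distrib.symm
    _ ≤ ∏ _i : Fin d, (7 * d ^ 2 : ℝ) :=
        Finset.prod_le_prod (fun i _ => by positivity) fun i _ => hfac i
    _ = _ := by simp

/-- Pairs `(x, v)` with `v` a lift to `ℝ ^ d` of the point `(x r₁ / N, …, x r_d / N)` of the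
torus. -/
def bohrLift (N : ℕ) {d : ℕ} (r : Fin d → ZMod N) :
    AddSubgroup (ZMod N × EuclideanSpace ℝ (Fin d)) where
  carrier := {p | ∀ i, ∃ k : ℤ, N * p.2 i = k ∧ (k : ZMod N) = p.1 * r i}
  zero_mem' := fun i => ⟨0, by simp⟩
  add_mem' := fun {p q} hp hq i => by
    obtain ⟨k, hk, hk'⟩ := hp i
    obtain ⟨l, hl, hl'⟩ := hq i
    refine ⟨k + l, ?_, ?_⟩
    · push_cast
      rw [← hk, ← hl, Prod.snd_add, PiLp.add_apply, mul_add]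
    · push_cast
      rw [hk', hl', Prod.fst_add, add_mul]
  neg_mem' := fun {p} hp i => by
    obtain ⟨k, hk, hk'⟩ := hp i
    refine ⟨-k, ?_, ?_⟩
    · push_cast
      rw [← hk, Prod.snd_neg, PiLp.neg_apply, mul_neg]
    · push_cast
      rw [hk', Prod.fst_neg, neg_mul]

theorem mem_bohrLift {N d : ℕ} {r : Fin d → ZMod N} {x : ZMod N}
    {v : EuclideanSpace ℝ (Fin d)} :
    (x, v) ∈ bohrLift N r ↔ ∀ i, ∃ k : ℤ, N * v i = k ∧ (k : ZMod N) = x * r i := Iff.rfl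

theorem exists_mem_bohrLift {N d : ℕ} [NeZero N] (r : Fin d → ZMod N) (x : ZMod N) :
    ∃ v : EuclideanSpace ℝ (Fin d), (x, v) ∈ bohrLift N r ∧ ‖v‖ ≤ d := by
  have hN : (0 : ℝ) < N := by exact_mod_cast NeZero.pos N
  refine ⟨WithLp.toLp 2 fun i => ((x * r i).val : ℝ) / N, fun i => ⟨(x * r i).val, ?_, ?_⟩, ?_⟩
  · simp only [Int.cast_natCast]
    field_simp
  · simp
  · rw [EuclideanSpace.norm_eq]
    refine (Real.sqrt_le_sqrt (y := ∑ _i : Fin d, 1) (Finset.sum_le_sum fun i _ => ?_)).trans ?_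
    · have : ((x * r i).val : ℝ) / N ≤ 1 := by
        rw [div_le_one hN]
        exact_mod_cast (ZMod.val_lt _).le
      rw [Real.norm_of_nonneg (by positivity)]
      exact pow_le_one₀ (by positivity) this
    · simp only [Finset.sum_const, Finset.card_univ, Fintype.card_fin, nsmul_eq_mul, mul_one]
      rw [Real.sqrt_le_left (by positivity)]
      exact_mod_cast Nat.le_self_pow two_ne_zero d

theorem bohrLift_eq_zero {N d : ℕ} [NeZero N] {r : Fin d → ZMod N}
    {v : EuclideanSpace ℝ (Fin d)} (h : (0, v) ∈ bohrLift N r) (hv : ‖v‖ < 1) : v = 0 := by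
  have hN : (0 : ℝ) < N := by exact_mod_cast NeZero.pos N
  ext i
  obtain ⟨k, hk, hk'⟩ := mem_bohrLift.1 h i
  rw [zero_mul, ZMod.intCast_zmod_eq_zero_iff_dvd] at hk'
  obtain ⟨j, rfl⟩ := hk'
  have hj : v i = j := by
    push_cast at hk
    exact mul_left_cancel₀ hN.ne' hk
  have hlt := (PiLp.norm_apply_le v i).trans_lt hv
  rw [hj, Real.norm_eq_abs] at hlt
  have : |j| < 1 := by exact_mod_cast hlt
  rw [hj, Int.abs_lt_one_iff.1 this]
  simp

theorem re_stdAddChar_nonneg_of_mem_bohrLift {N d : ℕ} [NeZero N] {r : Fin d → ZMod N}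
    {x : ZMod N} {v : EuclideanSpace ℝ (Fin d)} (h : (x, v) ∈ bohrLift N r) (hv : ‖v‖ ≤ 1 / 4)
    (i : Fin d) : 0 ≤ (ZMod.stdAddChar (r i * x) : ℂ).re := by
  have hN : (0 : ℝ) < N := by exact_mod_cast NeZero.pos N
  obtain ⟨k, hk, hk'⟩ := mem_bohrLift.1 h i
  have hvi := (PiLp.norm_apply_le v i).trans hv
  rw [Real.norm_eq_abs] at hvi
  rw [mul_comm, ← hk', ZMod.stdAddChar_coe]
  have : 2 * Real.pi * Complex.I * k / N = ((2 * Real.pi * v i : ℝ) : ℂ) * Complex.I := by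
    have hkC : (N : ℂ) * (v i : ℂ) = k := by exact_mod_cast congrArg (fun t : ℝ => (t : ℂ)) hk
    have hNC : (N : ℂ) ≠ 0 := by exact_mod_cast hN.ne'
    rw [← hkC]
    push_cast
    field_simp
  rw [this, Complex.exp_ofReal_mul_I_re]
  have hpi := Real.pi_pos
  refine Real.cos_nonneg_of_neg_pi_div_two_le_of_le ?_ ?_ <;>
    nlinarith [(abs_le.1 hvi).1, (abs_le.1 hvi).2]

/-- A Bohr set of rank `d` in `ZMod N` contains a large proper progression of dimension `d`. -/
theorem exists_progression_in_bohr {N d : ℕ} [NeZero N] (r : Fin d → ZMod N) {i₀ : Fin d}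
    (hr : r i₀ = 1) :
    ∃ (u : Fin d → ZMod N) (L : Fin d → ℕ),
      (∀ l : Fin d → ℤ, (∀ i, |l i| ≤ L i) →
        ∀ i, 0 ≤ (ZMod.stdAddChar (r i * ∑ j, l j • u j) : ℂ).re) ∧
      (∀ l l' : Fin d → ℤ, (∀ i, |l i| ≤ L i) → (∀ i, |l' i| ≤ L i) →
        ∑ j, l j • u j = ∑ j, l' j • u j → l = l') ∧
      N ≤ (28 * d ^ 3) ^ d * ∏ i, (2 * L i + 1) := by
  classical
  have hN : (0 : ℝ) < N := by exact_mod_cast NeZero.pos N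
  have hd : 0 < d := Fin.pos i₀
  have hd1 : (1 : ℝ) ≤ d := by exact_mod_cast hd
  set E := EuclideanSpace ℝ (Fin d)
  let Λ : AddSubgroup E := (bohrLift N r).map (AddMonoidHom.snd (ZMod N) E)
  have hΛ {v : E} : v ∈ Λ ↔ ∃ x, (x, v) ∈ bohrLift N r := by
    simp [Λ, AddSubgroup.mem_map]
  obtain ⟨v, b, hvΛ, hli, hv1, hb⟩ := exists_successive_minima (E := E) (d := d) (by simp [E]) Λ
    (M := (N : ℝ) ^ 2) (by positivity) (by
      intro v hv
      obtain ⟨x, hx⟩ := hΛ.1 hv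
      choose k hk _ using mem_bohrLift.1 hx
      refine ⟨∑ i, (k i).natAbs ^ 2, ?_⟩
      rw [EuclideanSpace.norm_sq_eq, Finset.mul_sum]
      push_cast
      refine Finset.sum_congr rfl fun i _ => ?_
      rw [Real.norm_eq_abs, sq_abs, ← mul_pow, hk i, Nat.cast_natAbs, Int.cast_abs, sq_abs])
    (by
      intro S hS
      have hex : ∃ i, EuclideanSpace.single i (1 : ℝ) ∉ S := by
        by_contra! hall
        refine hS (top_le_iff.1 ?_)
        rw [← (EuclideanSpace.basisFun (Fin d) ℝ).toBasis.span_eq, Submodule.span_le]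
        rintro _ ⟨i, rfl⟩
        simpa using hall i
      obtain ⟨i, hi⟩ := hex
      refine ⟨_, hΛ.2 ⟨0, fun j => ⟨if j = i then N else 0, ?_, ?_⟩⟩, hi,
        by rw [PiLp.norm_single, norm_one]⟩
      · by_cases hji : j = i <;> simp [hji]
      · by_cases hji : j = i <;> simp [hji])
  choose u hu using fun i => hΛ.1 (hvΛ i)
  have hv0 (i : Fin d) : 0 < ‖v i‖ := norm_pos_iff.2 (hli.ne_zero i)
  let L : Fin d → ℕ := fun i => ⌊1 / (4 * d * ‖v i‖)⌋₊
  have hlift (l : Fin d → ℤ) : (∑ j, l j • u j, ∑ j, l j • v j) ∈ bohrLift N r := by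
    have : (∑ j, l j • u j, ∑ j, l j • v j) = ∑ j, l j • (u j, v j) := by
      ext1
      · simp [Prod.fst_sum]
      · rw [Prod.snd_sum]; rfl
    rw [this]
    exact AddSubgroup.sum_mem _ fun j _ => AddSubgroup.zsmul_mem _ (hu j) _
  have hsmall (l : Fin d → ℤ) (hl : ∀ i, |l i| ≤ L i) : ‖∑ j, l j • v j‖ ≤ 1 / 4 := by
    have hterm (j : Fin d) : ‖l j • v j‖ ≤ 1 / (4 * d) := by
      have h1 : (|l j| : ℝ) ≤ L j := by exact_mod_cast hl j
      have h2 : (L j : ℝ) ≤ 1 / (4 * d * ‖v j‖) := Nat.floor_le (by positivity)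
      rw [← Int.cast_smul_eq_zsmul ℝ, norm_smul, Real.norm_eq_abs]
      calc |(l j : ℝ)| * ‖v j‖ ≤ 1 / (4 * d * ‖v j‖) * ‖v j‖ := by
            gcongr
            exact h1.trans h2
        _ = 1 / (4 * d) := by
            have := (hv0 j).ne'
            field_simp
    refine (norm_sum_le _ _).trans ((Finset.sum_le_sum fun j _ => hterm j).trans (le_of_eq ?_))
    simp
    field_simp
  refine ⟨u, L, fun l hl i => re_stdAddChar_nonneg_of_mem_bohrLift (hlift l) (hsmall l hl) i,
    fun l l' hl hl' heq => ?_, ?_⟩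
  · have hz := AddSubgroup.sub_mem _ (hlift l) (hlift l')
    rw [Prod.mk_sub_mk, heq, sub_self] at hz
    have hnorm := norm_sub_le (∑ j, l j • v j) (∑ j, l' j • v j)
    have h0 := bohrLift_eq_zero hz
      (hnorm.trans_lt (by linarith [hsmall l hl, hsmall l' hl']))
    rw [← Finset.sum_sub_distrib] at h0
    ext i
    have := Fintype.linearIndependent_iff.1 hli (fun j => ((l j - l' j : ℤ) : ℝ)) (by
      rw [← h0]
      exact Finset.sum_congr rfl fun j _ => by rw [Int.cast_smul_eq_zsmul, sub_smul]) i
    have : l i - l' i = 0 := by exact_mod_cast this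
    omega
  · choose W hW hWd using exists_mem_bohrLift r
    have hinj : Function.Injective W := by
      intro x y hxy
      have := AddSubgroup.sub_mem _ (hW x) (hW y)
      rw [Prod.mk_sub_mk, hxy, sub_self] at this
      obtain ⟨k, hk, hk'⟩ := mem_bohrLift.1 this i₀
      have hk0 : k = 0 := by simpa using hk.symm
      rw [hk0, hr, mul_one, Int.cast_zero] at hk'
      exact sub_eq_zero.1 hk'.symm
    have hpack := card_mul_prod_norm_le hd Λ v b hv0 hv1 hb (Finset.univ.image W)
      (by
        simp only [Finset.mem_image, Finset.mem_univ, true_and]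
        rintro _ ⟨x, rfl⟩
        exact hWd x)
      (by
        simp only [Finset.mem_image, Finset.mem_univ, true_and]
        rintro _ ⟨x, rfl⟩ _ ⟨y, rfl⟩
        exact hΛ.2 ⟨x - y, AddSubgroup.sub_mem _ (hW x) (hW y)⟩)
    rw [Finset.card_image_of_injective _ hinj, Finset.card_univ, ZMod.card] at hpack
    have hprod : (1 : ℝ) ≤ (4 * d : ℝ) ^ d * ((∏ i, (2 * L i + 1 : ℝ)) * ∏ i, ‖v i‖) := by
      rw [← Finset.prod_mul_distrib]
      have : (4 * d : ℝ) ^ d = ∏ _i : Fin d, (4 * d : ℝ) := by simp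
      rw [this, ← Finset.prod_mul_distrib]
      refine Finset.one_le_prod fun i _ => ?_
      have h1 : 1 / (4 * d * ‖v i‖) < L i + 1 := Nat.lt_floor_add_one _
      have := hv0 i
      rw [div_lt_iff₀ (by positivity)] at h1
      have h2 : 0 ≤ (L i : ℝ) * (4 * d * ‖v i‖) := by positivity
      linarith
    have hfinal : (N : ℝ) ≤ (28 * d ^ 3 : ℝ) ^ d * ∏ i, (2 * L i + 1 : ℝ) := by
      have hP : 0 ≤ (4 * d : ℝ) ^ d * ∏ i, (2 * L i + 1 : ℝ) := by positivity
      calc (N : ℝ) ≤ N * ((4 * d : ℝ) ^ d * ((∏ i, (2 * L i + 1 : ℝ)) * ∏ i, ‖v i‖)) :=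
            le_mul_of_one_le_right hN.le hprod
        _ = ((4 * d : ℝ) ^ d * ∏ i, (2 * L i + 1 : ℝ)) * (N * ∏ i, ‖v i‖) := by ring
        _ ≤ ((4 * d : ℝ) ^ d * ∏ i, (2 * L i + 1 : ℝ)) * (7 * d ^ 2 : ℝ) ^ d := by gcongr
        _ = ((4 * d) * (7 * d ^ 2) : ℝ) ^ d * ∏ i, (2 * L i + 1 : ℝ) := by
          rw [mul_pow (4 * d : ℝ)]
          ring
        _ = _ := by rw [show (4 * d : ℝ) * (7 * d ^ 2) = 28 * d ^ 3 by ring]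
    exact_mod_cast hfinal

/-- For a finite set `A` in a torsion-free divisible group there is a function to `ℤ` that is
additive on `A` and detects whether a difference of sums from `A` lying in `T` vanishes. -/
theorem exists_int_valued {V : Type*} [AddCommGroup V] [Module ℚ V] (A T : Finset V) :
    ∃ (z ζ : V → ℤ), ∀ {n : ℕ} (f g : Fin n → V), (∀ i, f i ∈ A) → (∀ i, g i ∈ A) →
      ∑ i, f i - ∑ i, g i ∈ T →
        ∑ i, z (f i) - ∑ i, z (g i) = ζ (∑ i, f i - ∑ i, g i) ∧
        (ζ (∑ i, f i - ∑ i, g i) = 0 ↔ ∑ i, f i = ∑ i, g i) := by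
  classical
  obtain ⟨F, hF⟩ := Module.exists_dual_forall_apply_ne_zero (K := ℚ)
    (fun t : {t : T // (t : V) ≠ 0} => ((t : T) : V)) fun t => t.2
  obtain ⟨⟨M, hM⟩, hint⟩ := IsLocalization.exist_integer_multiples_of_finset
    (nonZeroDivisors ℤ) (A.image F)
  have hM0 : (M : ℚ) ≠ 0 := by exact_mod_cast nonZeroDivisors.ne_zero hM
  have hz (a : V) : ∃ z : ℤ, a ∈ A → (z : ℚ) = M * F a := by
    by_cases ha : a ∈ A
    · obtain ⟨z, hz⟩ := hint (F a) (Finset.mem_image_of_mem F ha)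
      refine ⟨z, fun _ => ?_⟩
      simpa [Submonoid.smul_def] using hz
    · exact ⟨0, fun h => (ha h).elim⟩
  choose z hz using hz
  refine ⟨z, fun y => ⌊(M : ℚ) * F y⌋, fun f g hf hg hT => ?_⟩
  have hval : (M : ℚ) * F (∑ i, f i - ∑ i, g i) = (∑ i, z (f i) - ∑ i, z (g i) : ℤ) := by
    push_cast
    rw [map_sub, map_sum, map_sum, mul_sub, Finset.mul_sum, Finset.mul_sum]
    simp only [hz _ (hf _), hz _ (hg _)]
  have hfloor : ⌊(M : ℚ) * F (∑ i, f i - ∑ i, g i)⌋ = ∑ i, z (f i) - ∑ i, z (g i) := by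
    rw [hval, Int.floor_intCast]
  refine ⟨hfloor.symm, ?_⟩
  constructor
  · intro h
    by_contra hne
    refine hF ⟨⟨_, hT⟩, sub_ne_zero.2 hne⟩ ?_
    simp only at h
    rw [hfloor] at h
    rw [h, Int.cast_zero] at hval
    exact (mul_eq_zero.1 hval).resolve_left hM0
  · intro h
    simp [h]

/-- Ruzsa's model lemma. -/
theorem exists_freiman_model {V : Type*} [AddCommGroup V] [Module ℚ V] (A T : Finset V)
    (hT : ∀ f g : Fin 6 → V, (∀ i, f i ∈ A) → (∀ i, g i ∈ A) → ∑ i, f i - ∑ i, g i ∈ T)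
    {N : ℕ} (hN : 2 * T.card < N) :
    ∃ (A' : Finset V) (φ : V → ZMod N), A' ⊆ A ∧ A.card ≤ 6 * A'.card ∧
      ∀ f g : Fin 6 → V, (∀ i, f i ∈ A') → (∀ i, g i ∈ A') →
        (∑ i, φ (f i) = ∑ i, φ (g i) ↔ ∑ i, f i = ∑ i, g i) := by
  classical
  obtain ⟨z, ζ, hζ⟩ := exists_int_valued A T
  obtain ⟨p, hpge, hp⟩ := Nat.exists_infinite_primes (∑ y ∈ T, (ζ y).natAbs + 1)
  have : Fact p.Prime := ⟨hp⟩
  have hζp {y : V} (hy : y ∈ T) (h0 : ζ y ≠ 0) : (ζ y : ZMod p) ≠ 0 := by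
    intro h
    rw [ZMod.intCast_zmod_eq_zero_iff_dvd, Int.natCast_dvd] at h
    have h1 := Nat.le_of_dvd (Int.natAbs_pos.2 h0) h
    have h2 := Finset.single_le_sum (f := fun y => (ζ y).natAbs) (fun _ _ => Nat.zero_le _) hy
    omega
  set m : ℕ := (p - 1) / N with hm
  set J : Finset ℤ := (Finset.Icc (-(m : ℤ)) m).erase 0 with hJ
  set B : Finset (ZMod p) :=
    (T ×ˢ J).image fun yj => ((N * yj.2 : ℤ) : ZMod p) * (ζ yj.1 : ZMod p)⁻¹ with hB
  have hBcard : (insert 0 B).card < Fintype.card (ZMod p) := by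
    have hJcard : J.card = 2 * m := by
      rw [hJ, Finset.card_erase_of_mem (by simp), Int.card_Icc]
      omega
    have h1 : B.card ≤ T.card * (2 * m) := by
      rw [← hJcard, ← Finset.card_product]
      exact Finset.card_image_le
    have h2 := Finset.card_insert_le 0 B
    have h3 : N * m ≤ p - 1 := Nat.mul_div_le _ _
    have h4 := hp.two_le
    rw [ZMod.card]
    rcases Nat.eq_zero_or_pos m with h0 | h0
    · rw [h0] at h1
      omega
    · have h5 : 2 * T.card * m < N * m := Nat.mul_lt_mul_of_pos_right hN h0
      have h6 : T.card * (2 * m) = 2 * T.card * m := by ring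
      omega
  obtain ⟨q, hq⟩ : ∃ q, q ∉ insert 0 B := by
    by_contra! hall
    rw [Finset.eq_univ_iff_forall.2 hall, Finset.card_univ] at hBcard
    exact lt_irrefl _ hBcard
  rw [Finset.mem_insert, not_or] at hq
  have havoid {y : V} (hy : y ∈ T) (h0 : ζ y ≠ 0) {t : ℤ} (ht : |t| < p) (hNt : (N : ℤ) ∣ t) :
      (t : ZMod p) ≠ q * ζ y := by
    intro h
    obtain ⟨j, rfl⟩ := hNt
    have hqeq : q = ((N * j : ℤ) : ZMod p) * (ζ y : ZMod p)⁻¹ := by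
      rw [h, mul_assoc, mul_inv_cancel₀ (hζp hy h0), mul_one]
    have hj0 : j ≠ 0 := by
      rintro rfl
      exact hq.1 (by simpa using hqeq)
    refine hq.2 (Finset.mem_image.2 ⟨(y, j), Finset.mem_product.2 ⟨hy, ?_⟩, hqeq.symm⟩)
    have hjm : |j| ≤ m := by
      rw [Int.abs_eq_natAbs]
      have : N * j.natAbs ≤ p - 1 := by
        rw [abs_mul, Nat.abs_cast, Int.abs_eq_natAbs] at ht
        have : N * j.natAbs < p := by exact_mod_cast ht
        omega
      have := (Nat.le_div_iff_mul_le (by omega : 0 < N)).2 ((mul_comm _ _).trans_le this)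
      exact_mod_cast this
    exact Finset.mem_erase.2 ⟨hj0, Finset.mem_Icc.2 (abs_le.1 hjm)⟩
  let c : V → ℕ := fun a => (q * z a : ZMod p).val
  have hcp (a : V) : c a < p := ZMod.val_lt _
  have hcz (a : V) : ((c a : ℤ) : ZMod p) = q * z a := by simp [c]
  obtain ⟨k, hk⟩ : ∃ k, A.card ≤ 6 * (A.filter fun a => 6 * c a / p = k).card := by
    by_contra! hall
    have hmaps : ∀ a ∈ A, 6 * c a / p ∈ Finset.range 6 := by
      intro a _
      rw [Finset.mem_range, Nat.div_lt_iff_lt_mul hp.pos]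
      have := hcp a
      omega
    have h1 := Finset.card_le_mul_card_image_of_maps_to hmaps ((A.card - 1) / 6) fun k _ => by
      have := hall k
      omega
    have := hall 0
    rw [Finset.card_range] at h1
    omega
  refine ⟨A.filter fun a => 6 * c a / p = k, fun a => (c a : ZMod N), Finset.filter_subset _ _,
    hk, fun f g hf hg => ?_⟩
  simp only [Finset.mem_filter] at hf hg
  obtain ⟨hsum, hiff⟩ := hζ f g (fun i => (hf i).1) (fun i => (hg i).1)
    (hT f g (fun i => (hf i).1) fun i => (hg i).1)
  set t : ℤ := ∑ i, (c (f i) : ℤ) - ∑ i, (c (g i) : ℤ) with ht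
  have htp : (t : ZMod p) = q * ζ (∑ i, f i - ∑ i, g i) := by
    rw [← hsum, ht, Int.cast_sub, Int.cast_sum, Int.cast_sum]
    simp only [hcz]
    push_cast
    rw [mul_sub, Finset.mul_sum, Finset.mul_sum]
  have htlt : |t| < p := by
    have hterm (i : Fin 6) : 6 * |(c (f i) : ℤ) - c (g i)| < p := by
      have h1 := Nat.div_add_mod (6 * c (f i)) p
      have h2 := Nat.div_add_mod (6 * c (g i)) p
      rw [(hf i).2] at h1
      rw [(hg i).2] at h2
      have h3 := Nat.mod_lt (6 * c (f i)) hp.pos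
      have h4 := Nat.mod_lt (6 * c (g i)) hp.pos
      rw [← abs_of_pos (by norm_num : (0 : ℤ) < 6), ← abs_mul, abs_lt]
      constructor <;> push_cast [mul_sub] <;> omega
    have h1 : |t| ≤ ∑ i, |(c (f i) : ℤ) - c (g i)| := by
      rw [ht, ← Finset.sum_sub_distrib]
      exact Finset.abs_sum_le_sum_abs _ _
    have h2 : ∑ i, 6 * |(c (f i) : ℤ) - c (g i)| < ∑ _i : Fin 6, (p : ℤ) :=
      Finset.sum_lt_sum_of_nonempty Finset.univ_nonempty fun i _ => hterm i
    rw [← Finset.mul_sum] at h2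
    simp only [Finset.sum_const, Finset.card_univ, Fintype.card_fin, nsmul_eq_mul] at h2
    push_cast at h2
    linarith
  have hφ : ∑ i, (c (f i) : ZMod N) = ∑ i, (c (g i) : ZMod N) ↔ (N : ℤ) ∣ t := by
    rw [← ZMod.intCast_zmod_eq_zero_iff_dvd, ht]
    push_cast
    rw [sub_eq_zero]
  rw [hφ, ← hiff]
  constructor
  · intro hdvd
    by_contra h0
    exact havoid (hT f g (fun i => (hf i).1) fun i => (hg i).1) h0 htlt hdvd htp
  · intro h0
    rw [h0, Int.cast_zero, mul_zero, ZMod.intCast_zmod_eq_zero_iff_dvd] at htp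
    rw [Int.eq_zero_of_abs_lt_dvd htp htlt]
    exact dvd_zero _

theorem sum_add_single_smul {H : Type*} [AddCommGroup H] {d : ℕ} (w : Fin d → H) (l : Fin d → ℤ)
    (i : Fin d) :
    ∑ j, (l + Pi.single i 1 : Fin d → ℤ) j • w j = ∑ j, l j • w j + w i := by
  simp [add_smul, Finset.sum_add_distrib, Pi.single_apply, ite_smul]

theorem map_progression_eq_sum {G V : Type*} [AddCommGroup G] [AddCommGroup V] {d : ℕ}
    (u : Fin d → G) (L : Fin d → ℕ) (ψ : G → V) (h0 : ψ 0 = 0)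
    (hadd : ∀ (l : Fin d → ℤ) (i : Fin d), (∀ j, |l j| ≤ L j) →
      (∀ j, |(l + Pi.single i 1 : Fin d → ℤ) j| ≤ L j) →
        ψ (∑ j, l j • u j + u i) = ψ (∑ j, l j • u j) + ψ (u i))
    (l : Fin d → ℤ) (hl : ∀ j, |l j| ≤ L j) :
    ψ (∑ j, l j • u j) = ∑ j, l j • ψ (u j) := by
  classical
  induction hn : ∑ j, (l j).natAbs using Nat.strong_induction_on generalizing l with
  | _ n ih =>
    by_cases hzero : ∀ j, l j = 0
    · simp [hzero, h0]
    · push Not at hzero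
      obtain ⟨i, hi⟩ := hzero
      have hlt {l' : Fin d → ℤ} (h1 : (l' i).natAbs < (l i).natAbs)
          (h2 : ∀ j, j ≠ i → l' j = l j) : ∑ j, (l' j).natAbs < n := by
        rw [← hn]
        refine Finset.sum_lt_sum (fun j _ => ?_) ⟨i, Finset.mem_univ _, h1⟩
        by_cases hj : j = i
        · rw [hj]; exact h1.le
        · rw [h2 j hj]
      have hbox {l' : Fin d → ℤ} (h1 : (l' i).natAbs < (l i).natAbs)
          (h2 : ∀ j, j ≠ i → l' j = l j) (j : Fin d) : |l' j| ≤ L j := by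
        by_cases hj : j = i
        · have := hl i
          rw [Int.abs_eq_natAbs] at this
          rw [hj, Int.abs_eq_natAbs]
          omega
        · rw [h2 j hj]; exact hl j
      have hne (c : ℤ) (j : Fin d) (hj : j ≠ i) : (l + Pi.single i c : Fin d → ℤ) j = l j := by
        simp [hj]
      rcases lt_or_gt_of_ne hi with hneg | hpos
      · have h1 : ((l + Pi.single i 1 : Fin d → ℤ) i).natAbs < (l i).natAbs := by
          rw [Pi.add_apply, Pi.single_eq_same]
          omega
        have h2 := ih _ (hlt h1 (hne 1)) _ (hbox h1 (hne 1)) rfl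
        rw [sum_add_single_smul, sum_add_single_smul, hadd l i hl (hbox h1 (hne 1))] at h2
        exact add_right_cancel h2
      · have h1 : ((l + Pi.single i (-1) : Fin d → ℤ) i).natAbs < (l i).natAbs := by
          rw [Pi.add_apply, Pi.single_eq_same]
          omega
        have hl' : l = (l + Pi.single i (-1)) + Pi.single i 1 := by
          rw [add_assoc, ← Pi.single_add]
          simp
        have h2 := ih _ (hlt h1 (hne (-1))) _ (hbox h1 (hne (-1))) rfl
        have h3 := hadd _ i (hbox h1 (hne (-1))) (by rw [← hl']; exact hl)
        rw [h2, ← sum_add_single_smul, ← sum_add_single_smul, ← hl'] at h3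
        exact h3

/-- A set `A` of small doubling has a large progression of bounded dimension in `2A - 2A`. -/
theorem exists_large_progression {V : Type*} [AddCommGroup V] [Module ℚ V] (A T : Finset V)
    (hA : A.Nonempty)
    (hT : ∀ f g : Fin 6 → V, (∀ i, f i ∈ A) → (∀ i, g i ∈ A) → ∑ i, f i - ∑ i, g i ∈ T)
    {R : ℕ} (hR : T.card ≤ R * A.card) :
    ∃ (d : ℕ) (x : Fin d → V) (L : Fin d → ℕ) (P : Finset V),
      d ≤ 2 * (6 * (2 * R + 1)) ^ 2 + 1 ∧ (P : Set V) = AddProgression x L ∧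
      (∀ v ∈ P, ∃ a ∈ A, ∃ b ∈ A, ∃ c ∈ A, ∃ e ∈ A, v = a + b - c - e) ∧
      A.card ≤ 6 * (28 * d ^ 3) ^ d * P.card := by
  classical
  obtain ⟨N, hN⟩ : ∃ N, N = 2 * T.card + 1 := ⟨_, rfl⟩
  have : NeZero N := ⟨by omega⟩
  obtain ⟨A', φ, hA'A, hcard, hφ⟩ := exists_freiman_model A T hT (N := N) (by omega)
  have hφ6 (a₁ a₂ a₃ a₄ a₅ a₆ b₁ b₂ b₃ b₄ b₅ b₆ : A') :
      φ a₁ + φ a₂ + φ a₃ + φ a₄ + φ a₅ + φ a₆ = φ b₁ + φ b₂ + φ b₃ + φ b₄ + φ b₅ + φ b₆ ↔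
      (a₁ + a₂ + a₃ + a₄ + a₅ + a₆ : V) = b₁ + b₂ + b₃ + b₄ + b₅ + b₆ := by
    simpa only [Fin.sum_univ_six, Matrix.cons_val] using
      hφ (fun i => (![a₁, a₂, a₃, a₄, a₅, a₆] i : A')) (fun i => (![b₁, b₂, b₃, b₄, b₅, b₆] i : A'))
        (fun i => Subtype.prop _) fun i => Subtype.prop _
  have hA' : A'.Nonempty := Finset.card_pos.1 (by have := hA.card_pos; omega)
  have hinj : Set.InjOn φ A' := by
    intro a ha b hb hab
    let a' : A' := ⟨a, ha⟩
    simpa using (hφ6 a' a' a' a' a' a' ⟨b, hb⟩ a' a' a' a' a').1 (by simp [a', hab])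
  have hcard' : (A'.image φ).card = A'.card := Finset.card_image_of_injOn hinj
  obtain ⟨Γ, hΓ, hbog⟩ := exists_bohr_subset_two_sub_two N (6 * (2 * R + 1)) (A'.image φ)
    (hA'.image φ) (by
      rw [hcard', hN]
      have := hA'.card_pos
      nlinarith [Nat.mul_le_mul_left (2 * R) hcard])
  set Γ' := insert 1 Γ with hΓ'
  set r : Fin Γ'.card → ZMod N := fun i => (Γ'.equivFin.symm i : ZMod N) with hr
  have hrsurj {s : ZMod N} (hs : s ∈ Γ') : ∃ i, r i = s := ⟨Γ'.equivFin ⟨s, hs⟩, by simp [hr]⟩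
  obtain ⟨i₀, hi₀⟩ := hrsurj (Finset.mem_insert_self 1 Γ)
  obtain ⟨u, L, hu, hproper, hNle⟩ := exists_progression_in_bohr r hi₀
  let Y : Set (ZMod N) := {y | ∃ a b c e : A', y = φ a + φ b - φ c - φ e}
  have hY (l : Fin Γ'.card → ℤ) (hl : ∀ i, |l i| ≤ L i) : ∑ j, l j • u j ∈ Y := by
    obtain ⟨_, ha, _, hb, _, hc, _, he, h⟩ := hbog (∑ j, l j • u j) fun s hs => by
      obtain ⟨i, rfl⟩ := hrsurj (Finset.mem_insert_of_mem hs)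
      exact hu l hl i
    simp only [Finset.mem_image] at ha hb hc he
    obtain ⟨a, ha, rfl⟩ := ha
    obtain ⟨b, hb, rfl⟩ := hb
    obtain ⟨c, hc, rfl⟩ := hc
    obtain ⟨e, he, rfl⟩ := he
    exact ⟨⟨a, ha⟩, ⟨b, hb⟩, ⟨c, hc⟩, ⟨e, he⟩, h⟩
  have := hA'.to_subtype
  choose! a b c e hy using fun y (h : y ∈ Y) => h
  let ψ : ZMod N → V := fun y => a y + b y - c y - e y
  have hψadd {y y' : ZMod N} (h : y ∈ Y) (h' : y' ∈ Y) (h'' : y + y' ∈ Y) :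
      ψ (y + y') = ψ y + ψ y' := by
    have := (hφ6 (a y) (b y) (a y') (b y') (c (y + y')) (e (y + y'))
      (c y) (e y) (c y') (e y') (a (y + y')) (b (y + y'))).1 (by
        linear_combination hy _ h'' - hy _ h - hy _ h')
    rw [← sub_eq_zero] at this ⊢
    rw [← neg_eq_zero, ← this]
    simp only [ψ]
    abel
  have hψinj {y y' : ZMod N} (h : y ∈ Y) (h' : y' ∈ Y) (heq : ψ y = ψ y') : y = y' := by
    have := (hφ6 (a y) (b y) (c y') (e y') (a y) (a y)
      (c y) (e y) (a y') (b y') (a y) (a y)).2 (by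
        rw [← sub_eq_zero] at heq ⊢
        rw [← heq]
        simp only [ψ]
        abel)
    linear_combination hy _ h - hy _ h' + this
  have h0Y : (0 : ZMod N) ∈ Y := by simpa using hY 0 (by simp)
  have hψ0 : ψ 0 = 0 := by simpa using hψadd h0Y h0Y (by simpa using h0Y)
  have huY {i : Fin Γ'.card} (hi : L i ≠ 0) : u i ∈ Y := by
    have := hY (Pi.single i 1) fun j => by
      by_cases hj : j = i
      · subst hj
        simp
        omega
      · simp [hj]
    simpa [Pi.single_apply, ite_smul] using this
  have hsum := map_progression_eq_sum u L ψ hψ0 fun l i hl hl' => by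
    have h1 := hY _ hl'
    have hLi : L i ≠ 0 := by
      intro h0
      have h2 := hl i
      have h3 := hl' i
      rw [Pi.add_apply, Pi.single_eq_same] at h3
      rw [h0, Nat.cast_zero, abs_nonpos_iff] at h2 h3
      omega
    refine hψadd (hY _ hl) (huY hLi) ?_
    simpa [add_smul, Finset.sum_add_distrib, Pi.single_apply, ite_smul] using h1
  let box : Finset (Fin Γ'.card → ℤ) := Fintype.piFinset fun i => Finset.Icc (-(L i : ℤ)) (L i)
  have hbox {l : Fin Γ'.card → ℤ} : l ∈ box ↔ ∀ i, |l i| ≤ L i := by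
    simp [box, Fintype.mem_piFinset, abs_le]
  refine ⟨Γ'.card, fun i => ψ (u i), L, box.image fun l => ∑ j, l j • ψ (u j), ?_, ?_, ?_, ?_⟩
  · exact (Finset.card_insert_le _ _).trans (by omega)
  · ext v
    simp only [Finset.coe_image, Set.mem_image, Finset.mem_coe, hbox, AddProgression,
      Set.mem_ofPred_eq]
    simp only [eq_comm]
  · intro v hv
    obtain ⟨l, hl, rfl⟩ := Finset.mem_image.1 hv
    rw [hbox] at hl
    have h1 := hY l hl
    exact ⟨_, hA'A (a _).2, _, hA'A (b _).2, _, hA'A (c _).2, _, hA'A (e _).2, (hsum l hl).symm⟩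
  · have hPcard : (box.image fun l => ∑ j, l j • ψ (u j)).card = ∏ i, (2 * L i + 1) := by
      rw [Finset.card_image_of_injOn, Fintype.card_piFinset]
      · refine Finset.prod_congr rfl fun i _ => ?_
        rw [Int.card_Icc]
        omega
      · intro l hl l' hl' h
        rw [Finset.mem_coe, hbox] at hl hl'
        simp only [← hsum l hl, ← hsum l' hl'] at h
        exact hproper l l' hl hl' (hψinj (hY l hl) (hY l' hl') h)
    rw [hPcard, mul_assoc]
    refine hcard.trans (Nat.mul_le_mul_left 6 (le_trans ?_ hNle))
    rw [← hcard']
    exact (Finset.card_le_univ _).trans_eq (ZMod.card N)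

theorem mem_nsmul_iff_mem_nfoldSum {V : Type*} [AddCommGroup V] [DecidableEq V] {A : Finset V}
    {n : ℕ} {v : V} : v ∈ n • A ↔ v ∈ nfoldSum n (A : Set V) := by
  rw [Finset.mem_nsmul]
  constructor
  · rintro ⟨f, rfl⟩
    exact ⟨fun i => f i, fun i => (f i).2, List.sum_ofFn⟩
  · rintro ⟨f, hf, rfl⟩
    exact ⟨fun i => ⟨f i, hf i⟩, List.sum_ofFn⟩

theorem addProgression_append {V : Type*} [AddCommGroup V] {k k' : ℕ} (x : Fin k → V)
    (L : Fin k → ℕ) (y : Fin k' → V) (M : Fin k' → ℕ) :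
    AddProgression (Fin.append x y) (Fin.append L M) = AddProgression x L + AddProgression y M := by
  ext v
  rw [Set.mem_add]
  constructor
  · rintro ⟨l, hl, rfl⟩
    refine ⟨_, ⟨fun i => l (Fin.castAdd k' i), fun i => ?_, rfl⟩, _,
      ⟨fun i => l (Fin.natAdd k i), fun i => ?_, rfl⟩, ?_⟩
    · simpa using hl (Fin.castAdd k' i)
    · simpa using hl (Fin.natAdd k i)
    · simp [Fin.sum_univ_add]
  · rintro ⟨_, ⟨l, hl, rfl⟩, _, ⟨l', hl', rfl⟩, rfl⟩
    refine ⟨Fin.append l l', fun i => ?_, by simp [Fin.sum_univ_add]⟩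
    induction i using Fin.addCases with
    | left i => simpa using hl i
    | right i => simpa using hl' i

theorem addProgression_two_mul {V : Type*} [AddCommGroup V] {k : ℕ} (x : Fin k → V)
    (L : Fin k → ℕ) :
    AddProgression x (2 * L) = AddProgression x L - AddProgression x L := by
  ext v
  rw [Set.mem_sub]
  constructor
  · rintro ⟨l, hl, rfl⟩
    refine ⟨_, ⟨fun i => max (-(L i : ℤ)) (min (L i) (l i)), fun i => ?_, rfl⟩, _,
      ⟨fun i => max (-(L i : ℤ)) (min (L i) (l i)) - l i, fun i => ?_, rfl⟩, ?_⟩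
    · rw [abs_le]
      dsimp only
      omega
    · have := abs_le.1 (hl i)
      simp only [Pi.mul_apply, Pi.ofNat_apply, Nat.cast_mul, Nat.cast_ofNat] at this
      rw [abs_le]
      dsimp only
      omega
    · simp [← Finset.sum_sub_distrib, ← sub_smul]
  · rintro ⟨_, ⟨l, hl, rfl⟩, _, ⟨l', hl', rfl⟩, rfl⟩
    refine ⟨l - l', fun i => ?_, by simp [← Finset.sum_sub_distrib, ← sub_smul]⟩
    have h1 := abs_le.1 (hl i)
    have h2 := abs_le.1 (hl' i)
    simp only [Pi.mul_apply, Pi.ofNat_apply, Nat.cast_mul, Nat.cast_ofNat, Pi.sub_apply]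
    rw [abs_le]
    omega

theorem addProgression_eq_pos {V : Type*} [AddCommGroup V] {k : ℕ} (x : Fin k → V)
    (L : Fin k → ℕ) :
    AddProgression x L =
      AddProgression (fun i => if L i = 0 then 0 else x i) (fun i => max 1 (L i)) := by
  ext v
  constructor
  · rintro ⟨l, hl, rfl⟩
    refine ⟨l, fun i => (hl i).trans (by simp), Finset.sum_congr rfl fun i _ => ?_⟩
    dsimp only
    split_ifs with h
    · have := hl i
      rw [h, Nat.cast_zero, abs_nonpos_iff] at this
      simp [this]
    · rfl
  · rintro ⟨l, hl, rfl⟩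
    refine ⟨fun i => if L i = 0 then 0 else l i, fun i => ?_, Finset.sum_congr rfl fun i _ => ?_⟩
    · have := hl i
      dsimp only at this ⊢
      split_ifs with h
      · simp
      · rwa [max_eq_right (Nat.one_le_iff_ne_zero.2 h)] at this
    · dsimp only
      split_ifs <;> simp

/-- `Q` is a progression of dimension `k` contained in `n • A`. -/
def IsProgressionIn {V : Type*} [AddCommGroup V] [DecidableEq V] (A : Finset V) (k n : ℕ)
    (Q : Set V) : Prop :=
  ∃ (x : Fin k → V) (L : Fin k → ℕ), Q = AddProgression x L ∧ Q ⊆ ↑(n • A)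

namespace IsProgressionIn

variable {V : Type*} [AddCommGroup V] [DecidableEq V] {A : Finset V}

theorem add {k k' n n' : ℕ} {Q Q' : Set V} (h : IsProgressionIn A k n Q)
    (h' : IsProgressionIn A k' n' Q') : IsProgressionIn A (k + k') (n + n') (Q + Q') := by
  obtain ⟨x, L, rfl, hx⟩ := h
  obtain ⟨y, M, rfl, hy⟩ := h'
  refine ⟨_, _, (addProgression_append x L y M).symm, ?_⟩
  rw [add_nsmul, Finset.coe_add]
  exact Set.add_subset_add hx hy

theorem of_finset {S : Finset V} (hS : S ⊆ A) (h0 : 0 ∈ A) (hneg : ∀ a ∈ A, -a ∈ A) :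
    ∃ Q, IsProgressionIn A S.card S.card Q ∧ (S : Set V) ⊆ Q ∧ (S - S : Set V) ⊆ Q := by
  let x : Fin S.card → V := fun i => S.equivFin.symm i
  have hx {s : V} (hs : s ∈ S) : ∃ i, x i = s := ⟨S.equivFin ⟨s, hs⟩, by simp [x]⟩
  refine ⟨AddProgression x 1, ⟨x, 1, rfl, ?_⟩, ?_, ?_⟩
  · rintro _ ⟨l, hl, rfl⟩
    rw [Finset.mem_coe, mem_nsmul_iff_mem_nfoldSum]
    refine ⟨_, fun i => ?_, rfl⟩
    have hi : x i ∈ A := hS (S.equivFin.symm i).2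
    have := abs_le.1 (hl i)
    rw [Pi.one_apply, Nat.cast_one] at this
    obtain h | h | h : l i = -1 ∨ l i = 0 ∨ l i = 1 := by omega
    · simpa [h] using hneg _ hi
    · simpa [h] using h0
    · simpa [h] using hi
  · intro s hs
    obtain ⟨i, rfl⟩ := hx hs
    refine ⟨Pi.single i 1, fun j => ?_, by simp [Pi.single_apply, ite_smul]⟩
    rw [Pi.single_apply]
    split_ifs <;> simp
  · rintro _ ⟨s, hs, s', hs', rfl⟩
    obtain ⟨i, rfl⟩ := hx hs
    obtain ⟨j, rfl⟩ := hx hs'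
    refine ⟨Pi.single i 1 - Pi.single j 1, fun m => ?_,
      by simp [Pi.single_apply, ite_smul, sub_smul]⟩
    rw [Pi.sub_apply, Pi.single_apply, Pi.single_apply]
    split_ifs <;> simp

end IsProgressionIn

theorem exists_card_add_eq_or_subset_add_sub {V : Type*} [AddCommGroup V] [DecidableEq V]
    (A : Finset V) {Q : Finset V} (hQ : Q.Nonempty) (c : ℕ) :
    (∃ S ⊆ A, S.card = c ∧ (S + Q).card = c * Q.card) ∨
      ∃ S ⊆ A, S.card ≤ c ∧ A ⊆ S + (Q - Q) := by
  classical
  obtain ⟨F, hFmax⟩ := Finset.exists_maximal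
    (s := {F ∈ A.powerset | (SetLike.coe F).PairwiseDisjoint (· +ᵥ Q)}) 
    (Finset.filter_nonempty_iff.2 ⟨∅, Finset.empty_mem_powerset _, by simp⟩)
  simp only [Finset.mem_filter, Finset.mem_powerset] at hFmax
  obtain ⟨hFA, hF⟩ := hFmax.1
  rcases le_total F.card c with hFc | hFc
  · refine Or.inr ⟨F, hFA, hFc, fun a ha => ?_⟩
    by_cases haF : a ∈ F
    · obtain ⟨q, hq⟩ := hQ
      exact Finset.mem_add.2 ⟨a, haF, 0, Finset.mem_sub.2 ⟨q, hq, q, hq, sub_self q⟩, add_zero a⟩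
    by_cases! H : ∀ b ∈ F, Disjoint (a +ᵥ Q) (b +ᵥ Q)
    · refine (hFmax.not_gt ?_ (Finset.ssubset_insert haF)).elim
      rw [Finset.insert_subset_iff, Finset.coe_insert]
      exact ⟨⟨ha, hFA⟩, hF.insert fun _ hb _ => H _ hb⟩
    simp_rw [Finset.not_disjoint_iff, ← Finset.neg_vadd_mem_iff] at H
    obtain ⟨b, hb, q, hq₁, hq₂⟩ := H
    exact Finset.mem_add.2 ⟨b, hb, -b + a, Finset.mem_sub.2 ⟨_, hq₂, _, hq₁, by simp⟩, by simp⟩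
  · obtain ⟨S, hSF, hS⟩ := Finset.exists_subset_card_eq hFc
    refine Or.inl ⟨S, hSF.trans hFA, hS, ?_⟩
    have : (S : Set V).PairwiseDisjoint (· +ᵥ Q) := hF.subset (by simpa using hSF)
    rw [Finset.card_add_iff.2 (Finset.pairwiseDisjoint_vadd_iff.1 this), hS]

/-- Chang's covering argument. -/
theorem exists_progression_covering {V : Type*} [AddCommGroup V] [DecidableEq V]
    {A P : Finset V} (h0 : 0 ∈ A) (hneg : ∀ a ∈ A, -a ∈ A) (hP : P.Nonempty) {m : ℕ}
    (hPm : P ⊆ m • A) (c t : ℕ) (ht : ((m + t) • A).card < c ^ t * P.card) :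
    ∃ r ≤ c * t, ∃ R, IsProgressionIn A r r R ∧ (A : Set V) ⊆ (P - P : Set V) + R := by
  by_contra! hcon
  suffices H : ∀ u ≤ t, ∃ Q : Finset V, Q.Nonempty ∧ Q ⊆ (m + u) • A ∧ c ^ u * P.card ≤ Q.card ∧
      ∃ R, IsProgressionIn A (c * u) (c * u) R ∧ (Q - Q : Set V) ⊆ (P - P : Set V) + R by
    obtain ⟨Q, -, hQ, hQc, -⟩ := H t le_rfl
    exact absurd (hQc.trans (Finset.card_le_card hQ)) ht.not_ge
  have hc : c ≠ 0 := by
    rintro rfl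
    have hA : 0 < ((m + t) • A).card := Finset.card_pos.2 (Finset.Nonempty.nsmul ⟨0, h0⟩)
    rcases Nat.eq_zero_or_pos t with rfl | h
    · have := Finset.card_le_card hPm
      simp at ht
      omega
    · rw [zero_pow h.ne', zero_mul] at ht
      omega
  intro u
  induction u with
  | zero =>
    obtain ⟨R, hR, -⟩ := IsProgressionIn.of_finset (Finset.empty_subset A) h0 hneg
    have hR0 : (0 : V) ∈ R := by
      obtain ⟨x, L, rfl, -⟩ := hR
      exact ⟨0, by simp, by simp only [Pi.zero_apply, zero_smul, Finset.sum_const_zero]⟩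
    intro _
    exact ⟨P, hP, hPm, by simp, R, hR, fun v hv => Set.mem_add.2 ⟨v, hv, 0, hR0, add_zero v⟩⟩
  | succ u ih =>
    intro hu
    obtain ⟨Q, hQ, hQm, hQc, R, hR, hQR⟩ := ih (by omega)
    rcases exists_card_add_eq_or_subset_add_sub A hQ c with ⟨S, hSA, hSc, hSQ⟩ | ⟨S, hSA, hSc, hAS⟩
    · obtain ⟨R', hR', -, hSR'⟩ := IsProgressionIn.of_finset hSA h0 hneg
      rw [hSc] at hR'
      refine ⟨S + Q, Finset.Nonempty.add (Finset.card_pos.1 (by omega)) hQ, ?_, ?_, R + R',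
        hR.add hR', ?_⟩
      · rw [← add_assoc, add_nsmul, one_nsmul, add_comm S]
        exact Finset.add_subset_add hQm hSA
      · rw [hSQ, pow_succ', mul_assoc]
        exact Nat.mul_le_mul_left c hQc
      · rw [Finset.coe_add, add_sub_add_comm, add_comm, ← add_assoc]
        exact Set.add_subset_add hQR hSR'
    · obtain ⟨R', hR', hSR', -⟩ := IsProgressionIn.of_finset hSA h0 hneg
      refine absurd ?_ (hcon (c * u + S.card) ?_ _ (hR.add hR'))
      · refine (Finset.coe_subset.2 hAS).trans ?_
        rw [Finset.coe_add, Finset.coe_sub, add_comm, ← add_assoc]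
        exact Set.add_subset_add hQR hSR'
      · calc c * u + S.card ≤ c * (u + 1) := by rw [mul_add]; omega
          _ ≤ c * t := Nat.mul_le_mul_left c hu

/-- A progression covering `A` and contained in a sumset of `A`, with quantitative bounds. -/
theorem exists_progression_of_add_subset_add {V : Type*} [AddCommGroup V] [Module ℚ V]
    [DecidableEq V] {A X : Finset V} (h0 : 0 ∈ A) (hneg : ∀ a ∈ A, -a ∈ A) {K : ℕ} (hK : 2 ≤ K)
    (hX : X.card ≤ K) (hAX : A + A ⊆ X + A) :
    ∃ k ≤ K ^ 100, ∃ n ≤ K ^ 100, 0 < n ∧ ∃ Q, IsProgressionIn A k n Q ∧ (A : Set V) ⊆ Q := by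
  have hgrowth (n : ℕ) : ((n + 1) • A).card ≤ K ^ n * A.card := by
    have h1 := Finset.nsmul_subset_nsmul_add_of_sq_subset_add
      (by rwa [two_nsmul]) (Nat.succ_ne_zero n) (s := A) (t := X)
    calc ((n + 1) • A).card ≤ (n • X + A).card := Finset.card_le_card h1
      _ ≤ (n • X).card * A.card := Finset.card_add_le
      _ ≤ K ^ n * A.card := by
        gcongr
        exact Finset.card_nsmul_le.trans (Nat.pow_le_pow_left hX n)
  obtain ⟨d, x, L, P, hd, hP, hPA, hAP⟩ := exists_large_progression A (12 • A) ⟨0, h0⟩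
    (fun f g hf hg => by
      rw [show 12 = 6 + 6 from rfl, add_nsmul, sub_eq_add_neg, ← Finset.sum_neg_distrib]
      exact Finset.add_mem_add (mem_nsmul_iff_mem_nfoldSum.2 ⟨f, hf, rfl⟩)
        (mem_nsmul_iff_mem_nfoldSum.2 ⟨_, fun i => hneg _ (hg i), rfl⟩)) (hgrowth 11)
  have hP0 : P.Nonempty := ⟨0, by
    rw [← Finset.mem_coe, hP]
    exact ⟨0, by simp, by simp⟩⟩
  have hP4 : P ⊆ 4 • A := fun v hv => by
    obtain ⟨a, ha, b, hb, c, hc, e, he, rfl⟩ := hPA v hv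
    refine mem_nsmul_iff_mem_nfoldSum.2 ⟨![a, b, -c, -e], fun i => ?_, ?_⟩
    · fin_cases i <;> simp [*]
    · simp [Fin.sum_univ_four, sub_eq_add_neg]
  have hPP : IsProgressionIn A d 8 (P - P : Set V) := by
    refine ⟨x, 2 * L, by rw [addProgression_two_mul, hP], ?_⟩
    rw [show 8 = 4 + 4 from rfl, add_nsmul]
    rintro _ ⟨p, hp, q, hq, rfl⟩
    have hq' : -q ∈ P := by
      rw [hP] at hq
      rw [← Finset.mem_coe, hP]
      obtain ⟨l, hl, rfl⟩ := hq
      exact ⟨-l, by simpa using hl, by simp⟩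
    change p - q ∈ 4 • A + 4 • A
    rw [sub_eq_add_neg]
    exact Finset.add_mem_add (hP4 hp) (hP4 hq')
  obtain ⟨s, hs⟩ : ∃ s, s = 3 + (5 + d * 3) * d := ⟨_, rfl⟩
  have hAs : A.card ≤ 2 ^ s * P.card := by
    refine hAP.trans (Nat.mul_le_mul_right _ ?_)
    rw [hs, pow_add, pow_mul, pow_add, pow_mul]
    gcongr
    · norm_num
    · norm_num
    · exact Nat.lt_two_pow_self.le
  obtain ⟨t, ht⟩ : ∃ t, t = K * 3 + s + 1 := ⟨_, rfl⟩
  have hcard : ((4 + t) • A).card < (2 * K) ^ t * P.card := by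
    have hP1 := hP0.card_pos
    calc ((4 + t) • A).card ≤ K ^ (3 + t) * A.card := by
          rw [show 4 + t = 3 + t + 1 by omega]; exact hgrowth _
      _ ≤ K ^ (3 + t) * (2 ^ s * P.card) := by gcongr
      _ = K ^ 3 * 2 ^ s * (K ^ t * P.card) := by ring
      _ < 2 ^ t * (K ^ t * P.card) := by
        gcongr
        calc K ^ 3 * 2 ^ s ≤ (2 ^ K) ^ 3 * 2 ^ s := by gcongr; exact Nat.lt_two_pow_self.le
          _ = 2 ^ (K * 3 + s) := by rw [pow_add, pow_mul]
          _ < 2 ^ t := Nat.pow_lt_pow_right one_lt_two (by omega)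
      _ = (2 * K) ^ t * P.card := by ring
  obtain ⟨r, hr, R, hR, hAR⟩ := exists_progression_covering h0 hneg hP0 hP4 (2 * K) t hcard
  have hpow {a n : ℕ} (h : a ≤ K ^ n) (e : ℕ) (b : ℕ) (hb : b ≤ 2 ^ e) : b * a ≤ K ^ (e + n) := by
    rw [pow_add]
    exact Nat.mul_le_mul (hb.trans (Nat.pow_le_pow_left hK e)) h
  have hd' : d ≤ K ^ 32 := by
    have h1 : 1 ≤ K ^ 11 := Nat.one_le_pow _ _ (by omega)
    have h2 : 2 * (6 * (2 * K ^ 11 + 1)) ^ 2 + 1 ≤ 1024 * K ^ 22 := by nlinarith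
    exact hd.trans (h2.trans (hpow le_rfl 10 1024 (by norm_num)))
  have hs' : s ≤ K ^ 68 := by
    have h1 : 1 ≤ K ^ 64 := Nat.one_le_pow _ _ (by omega)
    have h2 : d * d ≤ K ^ 64 := (Nat.mul_le_mul hd' hd').trans_eq (by ring)
    have h3 : s ≤ 16 * K ^ 64 := by nlinarith [Nat.le_mul_self d]
    exact h3.trans (hpow le_rfl 4 16 (by norm_num))
  have ht' : t ≤ K ^ 71 := by
    have h1 : 1 ≤ K ^ 68 := Nat.one_le_pow _ _ (by omega)
    have h2 : K ≤ K ^ 68 := Nat.le_self_pow (by norm_num) K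
    exact (show t ≤ 8 * K ^ 68 by omega).trans (hpow le_rfl 3 8 (by norm_num))
  have hr' : r ≤ K ^ 73 := by
    refine hr.trans ?_
    calc 2 * K * t ≤ K * K * K ^ 71 := by gcongr
      _ = K ^ 73 := by ring
  have h100 : 16 * K ^ 73 ≤ K ^ 100 :=
    (hpow le_rfl 4 16 (by norm_num)).trans (Nat.pow_le_pow_right (by omega) (by norm_num))
  have h73 : K ^ 32 ≤ K ^ 73 := Nat.pow_le_pow_right (by omega) (by norm_num)
  have h1 : 1 ≤ K ^ 73 := Nat.one_le_pow _ _ (by omega)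
  exact ⟨d + r, by omega, 8 + r, by omega, by omega, _, hPP.add hR, hAR⟩

/-- The strong Freĭman–Ruzsa theorem in `ℝ^m`: a `K`-approximate group `A` satisfies
`A ⊆ P ⊆ NA` for a progression `P` of dimension `k ≤ K^C` and some `N ≤ K^C`. -/
theorem stmt15 :
    ∃ C : ℝ, 1 ≤ C ∧
      ∀ m : ℕ, 1 ≤ m → ∀ K : ℝ, 1 ≤ K →
        ∀ A : Set (Fin m → ℝ), A.Finite → IsAddApproxGroup K A →
          ∃ (k : ℕ) (x : Fin k → (Fin m → ℝ)) (L : Fin k → ℕ) (N : ℕ),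
            (∀ i, 0 < L i) ∧ (k : ℝ) ≤ K ^ C ∧ 0 < N ∧ (N : ℝ) ≤ K ^ C ∧
            A ⊆ AddProgression x L ∧ AddProgression x L ⊆ nfoldSum N A := by
  classical
  refine ⟨(100 : ℕ), by norm_num, fun m _ K hK A hA ⟨hneg, h0, X, hX, _, _, hXK, hAX⟩ => ?_⟩
  lift A to Finset (Fin m → ℝ) using hA
  lift X to Finset (Fin m → ℝ) using hX
  simp only [Finset.mem_coe, Set.ncard_coe_finset] at hneg h0 hXK
  rw [← Finset.coe_add, ← Finset.coe_add, Finset.coe_subset] at hAX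
  have hXK' : X.card ≤ ⌊K⌋₊ := Nat.le_floor hXK
  have hbound {n : ℕ} (hn : n ≤ ⌊K⌋₊ ^ 100) : (n : ℝ) ≤ K ^ ((100 : ℕ) : ℝ) := by
    rw [Real.rpow_natCast]
    calc (n : ℝ) ≤ (⌊K⌋₊ : ℝ) ^ 100 := by exact_mod_cast hn
      _ ≤ K ^ 100 := by gcongr; exact Nat.floor_le (by linarith)
  rcases Nat.lt_or_ge ⌊K⌋₊ 2 with hK2 | hK2
  · have hcard : (A + A).card ≤ A.card :=
      (Finset.card_le_card hAX).trans (Finset.card_add_le.trans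
        ((Nat.mul_le_mul_right _ (by omega : X.card ≤ 1)).trans_eq (one_mul _)))
    have hAA : A = A + A := Finset.eq_of_subset_of_card_le
      (fun a ha => Finset.mem_add.2 ⟨a, ha, 0, h0, add_zero a⟩) hcard
    have hnsmul (a : Fin m → ℝ) (ha : a ∈ A) (n : ℕ) : n • a ∈ A := by
      induction n with
      | zero => simpa using h0
      | succ n ih => rw [succ_nsmul, hAA]; exact Finset.add_mem_add ih ha
    have hA0 (a : Fin m → ℝ) (ha : a ∈ A) : a = 0 := by
      by_contra h
      have hinj : Function.Injective fun n : ℕ => n • a := fun n n' hn => by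
        simpa only [Nat.cast_inj] using smul_left_injective ℝ h
          (show (n : ℝ) • a = (n' : ℝ) • a by simpa only [Nat.cast_smul_eq_nsmul] using hn)
      exact Set.infinite_of_injective_forall_mem hinj (hnsmul a ha) A.finite_toSet
    refine ⟨0, Fin.elim0, Fin.elim0, 1, fun i => i.elim0, hbound (Nat.zero_le _), one_pos,
      hbound (Nat.one_le_pow _ _ (Nat.floor_pos.2 hK)), fun a ha => ?_, ?_⟩
    · exact ⟨0, fun i => i.elim0, by simpa using hA0 a ha⟩
    · rintro _ ⟨l, -, rfl⟩
      exact ⟨fun _ => 0, fun _ => h0, by simp⟩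
  · obtain ⟨k, hk, n, hn, hn0, _, ⟨x, L, rfl, hQ⟩, hAQ⟩ :=
      exists_progression_of_add_subset_add h0 hneg hK2 hXK' hAX
    rw [addProgression_eq_pos] at hQ hAQ
    exact ⟨k, _, _, n, fun i => by simp, hbound hk, hn0, hbound hn, hAQ,
      fun v hv => mem_nsmul_iff_mem_nfoldSum.1 (hQ hv)⟩
end
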